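/- arXiv:2203.02862 — 6 statements merged into one kernel-verified Lean document; each statement's English description precedes it below -/
import Mathlib

section
/- Let n ≥ 2 be an integer. Then the following set of polynomials is a basis of the complex vector space S_{n,2}: the monomials x_{r_1} x_{r_2} for all integers r_1, r_2 with 0 ≤ r_2 ≤ r_1 ≤ n−2−r_2, together with the binomials x_{k_1} x_{k_2} − (k_1/(k_2+1))·x_{k_1−1} x_{k_2+1} for all integers k_1, k_2 with 0 ≤ n−1−k_1 ≤ k_2 ≤ k_1−2. In particular, S_{n,2} = ⊕_{l=0}^{2n−4} S_{n,2,l} and dim S_{n,2} = n(n−1)/2. -/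
open MvPolynomial

/-- The jet inversion: given the jets `a j = x^{(j)}(t₀)` of a function `x` with
`x(t₀) ≠ 0`, `iota a j = (1/x)^{(j)}(t₀)`, defined by `iota a 0 = 1 / a 0` and the
recursion `∑_{j=0}^{k} (k.choose j) * a j * iota a (k - j) = 0` for `k ≥ 1`. -/
noncomputable def iota (a : ℕ → ℂ) : ℕ → ℂ
  | 0 => 1 / a 0
  | (k+1) => -(1 / a 0) * ∑ j ∈ Finset.range (k+1),
      ((k+1).choose (j+1) : ℂ) * a (j+1) * iota a (k - j)
  termination_by k => k
  decreasing_by exact Nat.lt_succ_of_le (Nat.sub_le k j)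

/-- `JetRel n ρ₁ ρ₂` means `ρ₁ ∼ₙ ρ₂`:  `ρ₁(a) = a₀ⁿ ρ₂(ιₙ(a))` whenever `a₀ ≠ 0`. -/
def JetRel (n : ℕ) (ρ₁ ρ₂ : MvPolynomial ℕ ℂ) : Prop :=
  ∀ a : ℕ → ℂ, a 0 ≠ 0 → eval a ρ₁ = (a 0) ^ n * eval (iota a) ρ₂

/-- The space `Sₙ` of polynomials `ρ₁ ∈ ℂ[x₀, …, x_{n-1}]` such that `ρ₁ ∼ₙ ρ₂` for some
polynomial `ρ₂ ∈ ℂ[x₀, …, x_{n-1}]`. -/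
noncomputable def Sn (n : ℕ) : Submodule ℂ (MvPolynomial ℕ ℂ) where
  carrier := {ρ₁ | ρ₁ ∈ supported ℂ (Set.Iio n) ∧
    ∃ ρ₂ ∈ supported ℂ (Set.Iio n), JetRel n ρ₁ ρ₂}
  add_mem' := by
    rintro p q ⟨hp, p₂, hp₂, hrp⟩ ⟨hq, q₂, hq₂, hrq⟩
    refine ⟨add_mem hp hq, p₂ + q₂, add_mem hp₂ hq₂, fun a ha => ?_⟩
    simp only [map_add, hrp a ha, hrq a ha, mul_add]
  zero_mem' := ⟨zero_mem _, 0, zero_mem _, fun a ha => by simp⟩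
  smul_mem' := by
    rintro c p ⟨hp, p₂, hp₂, hrp⟩
    refine ⟨Subalgebra.smul_mem _ hp c, c • p₂, Subalgebra.smul_mem _ hp₂ c, fun a ha => ?_⟩
    simp only [MvPolynomial.smul_eq_C_mul, map_mul, eval_C, hrp a ha]
    ring

/-- `S_{n,d}`: the homogeneous degree-`d` part of `Sₙ`. -/
noncomputable def Snd (n d : ℕ) : Submodule ℂ (MvPolynomial ℕ ℂ) :=
  Sn n ⊓ homogeneousSubmodule ℕ ℂ d

/-- `S_{n,d,l}`: the part of `S_{n,d}` of weighted degree `l`, where variable `xᵢ`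
has weight `i`. -/
noncomputable def Sndl (n d l : ℕ) : Submodule ℂ (MvPolynomial ℕ ℂ) :=
  Snd n d ⊓ weightedHomogeneousSubmodule ℂ (fun i : ℕ => i) l

/-- The Taylor series `∑ (a_j / j!) t^j` of a jet. -/
noncomputable def jetSeries (a : ℕ → ℂ) : PowerSeries ℂ :=
  PowerSeries.mk fun k => a k / (k.factorial : ℂ)

@[simp]
lemma coeff_jetSeries (a : ℕ → ℂ) (k : ℕ) :
    PowerSeries.coeff k (jetSeries a) = a k / (k.factorial : ℂ) :=
  PowerSeries.coeff_mk _ _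

lemma jetSeries_injective : Function.Injective jetSeries := by
  intro a b h
  ext k
  have hk := congrArg (PowerSeries.coeff k) h
  have : (k.factorial : ℂ) ≠ 0 := by exact_mod_cast k.factorial_ne_zero
  simpa [div_left_inj' this] using hk

lemma jetSeries_mul_iota {a : ℕ → ℂ} (ha : a 0 ≠ 0) :
    jetSeries a * jetSeries (iota a) = 1 := by
  ext k
  rw [PowerSeries.coeff_mul]
  simp only [coeff_jetSeries]
  rw [Finset.Nat.sum_antidiagonal_eq_sum_range_succ
    (fun i j => a i / (i.factorial : ℂ) * (iota a j / (j.factorial : ℂ)))]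
  rcases k with _ | k
  · simp [iota, ha]
  · rw [Finset.sum_range_succ', Nat.sub_zero, iota, PowerSeries.coeff_one,
      if_neg k.succ_ne_zero]
    have hterm : ∀ j ∈ Finset.range (k + 1),
        a (j + 1) / ((j + 1).factorial : ℂ) *
          (iota a (k + 1 - (j + 1)) / ((k + 1 - (j + 1)).factorial : ℂ)) =
        1 / ((k + 1).factorial : ℂ) *
          (((k + 1).choose (j + 1) : ℂ) * a (j + 1) * iota a (k - j)) := by
      intro j hj
      have hjk : j ≤ k := Nat.lt_succ_iff.mp (Finset.mem_range.mp hj)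
      rw [Nat.cast_choose ℂ (Nat.succ_le_succ hjk), Nat.add_sub_add_right]
      have h1 : ((j + 1).factorial : ℂ) ≠ 0 := by exact_mod_cast (j + 1).factorial_ne_zero
      have h2 : ((k - j).factorial : ℂ) ≠ 0 := by exact_mod_cast (k - j).factorial_ne_zero
      have h3 : ((k + 1).factorial : ℂ) ≠ 0 := by exact_mod_cast (k + 1).factorial_ne_zero
      field_simp
    rw [Finset.sum_congr rfl hterm, ← Finset.mul_sum]
    have h3 : ((k + 1).factorial : ℂ) ≠ 0 := by exact_mod_cast (k + 1).factorial_ne_zero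
    simp only [Nat.factorial_zero, Nat.cast_one]
    field_simp
    ring

lemma iota_eq_of_mul_eq_one {a b : ℕ → ℂ} (ha : a 0 ≠ 0)
    (h : jetSeries a * jetSeries b = 1) : iota a = b := by
  apply jetSeries_injective
  calc jetSeries (iota a) = jetSeries (iota a) * (jetSeries a * jetSeries b) := by
        rw [h, mul_one]
    _ = jetSeries a * jetSeries (iota a) * jetSeries b := by ring
    _ = jetSeries b := by rw [jetSeries_mul_iota ha, one_mul]

lemma iota_zero (a : ℕ → ℂ) : iota a 0 = 1 / a 0 := by rw [iota]

lemma iota_zero_ne_zero {a : ℕ → ℂ} (ha : a 0 ≠ 0) : iota a 0 ≠ 0 := by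
  rw [iota_zero]
  exact one_div_ne_zero ha

/-- Truncating the inverse jet at order `n` and inverting back does not change the jet
below order `n`. -/
lemma exists_iota_truncated {n : ℕ} (hn : 0 < n) {a : ℕ → ℂ} (ha : a 0 ≠ 0) :
    ∃ a' : ℕ → ℂ, (∀ j < n, a' j = a j) ∧
      iota a' = fun j => if j < n then iota a j else 0 := by
  set b : ℕ → ℂ := fun j => if j < n then iota a j else 0 with hb
  have hb0 : b 0 ≠ 0 := by simpa only [hb, hn, if_true] using iota_zero_ne_zero ha
  have hinv := jetSeries_mul_iota hb0
  have hdvd : PowerSeries.X ^ n ∣ jetSeries (iota b) - jetSeries a := by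
    have hsub : PowerSeries.X ^ n ∣ jetSeries (iota a) - jetSeries b := by
      rw [PowerSeries.X_pow_dvd_iff]
      intro m hm
      simp [hb, hm]
    have : jetSeries (iota b) - jetSeries a =
        jetSeries a * jetSeries (iota b) * (jetSeries (iota a) - jetSeries b) := by
      linear_combination jetSeries a * hinv - jetSeries (iota b) * jetSeries_mul_iota ha
    rw [this]
    exact hsub.mul_left _
  rw [PowerSeries.X_pow_dvd_iff] at hdvd
  have hj : ∀ j < n, iota b j = a j := by
    intro j hj
    have h := hdvd j hj
    have : (j.factorial : ℂ) ≠ 0 := by exact_mod_cast j.factorial_ne_zero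
    rw [map_sub, coeff_jetSeries, coeff_jetSeries, sub_eq_zero, div_left_inj' this] at h
    exact h
  refine ⟨iota b, hj, iota_eq_of_mul_eq_one (iota_zero_ne_zero hb0) ?_⟩
  rw [mul_comm, hinv]

/-- Functions of jets that become polynomial in the inverse jet after division by the
`N`-th power of the value. -/
noncomputable def poleSpace (N : ℕ) : Submodule ℂ ((ℕ → ℂ) → ℂ) where
  carrier := {f | ∃ ρ : MvPolynomial ℕ ℂ, ∀ a, a 0 ≠ 0 → f a = a 0 ^ N * eval (iota a) ρ}
  add_mem' := by
    rintro f g ⟨p, hp⟩ ⟨q, hq⟩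
    exact ⟨p + q, fun a ha => by simp [hp a ha, hq a ha, mul_add]⟩
  zero_mem' := ⟨0, fun a _ => by simp⟩
  smul_mem' := by
    rintro c f ⟨p, hp⟩
    exact ⟨C c * p, fun a ha => by simp [hp a ha]; ring⟩

lemma mul_mem_poleSpace {N M K : ℕ} {f g : (ℕ → ℂ) → ℂ} (hf : f ∈ poleSpace N)
    (hg : g ∈ poleSpace M) (hK : N + M = K) : (fun a => f a * g a) ∈ poleSpace K := by
  obtain ⟨p, hp⟩ := hf
  obtain ⟨q, hq⟩ := hg
  refine ⟨p * q, fun a ha => ?_⟩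
  simp only [hp a ha, hq a ha, map_mul, ← hK, pow_add]
  ring

lemma poleSpace_mono {N M : ℕ} (h : N ≤ M) : poleSpace N ≤ poleSpace M := by
  rintro f ⟨p, hp⟩
  refine ⟨X 0 ^ (M - N) * p, fun a ha => ?_⟩
  obtain ⟨k, rfl⟩ := Nat.exists_eq_add_of_le h
  rw [hp a ha, map_mul, map_pow, eval_X, iota_zero, Nat.add_sub_cancel_left, pow_add,
    one_div, inv_pow]
  field_simp

lemma iota_mem_poleSpace (j : ℕ) : (fun a => iota a j) ∈ poleSpace 0 :=
  ⟨X j, fun a _ => by simp⟩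

lemma value_mem_poleSpace : (fun a : ℕ → ℂ => a 0) ∈ poleSpace 1 :=
  ⟨1, fun a _ => by simp⟩

/-- The `k`-th Taylor coefficient of a jet. -/
noncomputable def taylor (k : ℕ) (a : ℕ → ℂ) : ℂ := a k / (k.factorial : ℂ)

lemma sum_iota_mul_taylor {a : ℕ → ℂ} (ha : a 0 ≠ 0) (k : ℕ) :
    ∑ i ∈ Finset.range (k + 1), taylor (i + 1) (iota a) * taylor (k - i) a =
      -taylor 0 (iota a) * taylor (k + 1) a := by
  have h := congrArg (PowerSeries.coeff (k + 1)) (jetSeries_mul_iota ha)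
  rw [mul_comm, PowerSeries.coeff_mul, PowerSeries.coeff_one, if_neg k.succ_ne_zero] at h
  simp only [coeff_jetSeries] at h
  rw [Finset.Nat.sum_antidiagonal_eq_sum_range_succ
    (fun i j => iota a i / (i.factorial : ℂ) * (a j / (j.factorial : ℂ))),
    Finset.sum_range_succ'] at h
  simp only [Nat.add_sub_add_right, Nat.sub_zero] at h
  simp only [taylor]
  linear_combination h

lemma taylor_zero_mul {a : ℕ → ℂ} (ha : a 0 ≠ 0) : a 0 * taylor 0 (iota a) = 1 := by
  simp [taylor, iota_zero, ha]

lemma taylor_iota_mem_poleSpace (j : ℕ) : (fun a => taylor j (iota a)) ∈ poleSpace 0 := by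
  convert (poleSpace 0).smul_mem ((j.factorial : ℂ)⁻¹) (iota_mem_poleSpace j) using 1
  funext a
  simp [taylor, div_eq_inv_mul]

/-- Membership in `poleSpace` only depends on the jets with nonzero value. -/
lemma poleSpace_congr {N : ℕ} {f g : (ℕ → ℂ) → ℂ} (hf : f ∈ poleSpace N)
    (h : ∀ a, a 0 ≠ 0 → g a = f a) : g ∈ poleSpace N := by
  obtain ⟨p, hp⟩ := hf
  exact ⟨p, fun a ha => (h a ha).trans (hp a ha)⟩

lemma taylor_mem_poleSpace (k : ℕ) : taylor k ∈ poleSpace (k + 1) := by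
  induction k using Nat.strong_induction_on with
  | _ k ih =>
    rcases k with _ | k
    · exact poleSpace_congr value_mem_poleSpace fun a _ => by simp [taylor]
    · have hsum : (∑ i ∈ Finset.range (k + 1),
          fun a => taylor (i + 1) (iota a) * taylor (k - i) a) ∈ poleSpace (k + 1) := by
        refine Submodule.sum_mem _ fun i _ => ?_
        refine mul_mem_poleSpace (taylor_iota_mem_poleSpace _)
          (poleSpace_mono ?_ (ih (k - i) (by omega))) (Nat.zero_add _)
        omega
      refine poleSpace_congr (mul_mem_poleSpace value_mem_poleSpace
        (Submodule.neg_mem _ hsum) (Nat.add_comm 1 (k + 1))) fun a ha => ?_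
      simp only [Pi.neg_apply, Finset.sum_apply]
      rw [sum_iota_mul_taylor ha]
      linear_combination -taylor (k + 1) a * taylor_zero_mul ha

/-- The sequence `0, y 0, y 1, …`. -/
def delay (y : ℕ → ℂ) : ℕ → ℂ
  | 0 => 0
  | k + 1 => y k

/-- The coefficients of `(t - s) y(s) y(t)`. -/
def crossMinor (y : ℕ → ℂ) (p q : ℕ) : ℂ := y p * delay y q - delay y p * y q

lemma sum_mul_delay (x y : ℕ → ℂ) (M : ℕ) :
    ∑ j ∈ Finset.range (M + 1), x (j + 1) * delay y (M - j) =
      ∑ j ∈ Finset.range (M + 1), x j * y (M - j) - x 0 * y M := by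
  rw [Finset.sum_range_succ, Finset.sum_range_succ', Nat.sub_self]
  have : ∀ j ∈ Finset.range M, x (j + 1) * delay y (M - j) = x (j + 1) * y (M - (j + 1)) := by
    intro j hj
    have hjM := Finset.mem_range.mp hj
    obtain ⟨d, rfl⟩ := Nat.exists_eq_add_of_lt hjM
    rw [show j + d + 1 - j = d + 1 by omega, show j + d + 1 - (j + 1) = d by omega]
    rfl
  rw [Finset.sum_congr rfl this]
  simp [delay]

lemma sum_mul_crossMinor {x y : ℕ → ℂ}
    (h : ∀ k, ∑ i ∈ Finset.range (k + 1), x (i + 1) * y (k - i) = -x 0 * y (k + 1))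
    (K M : ℕ) :
    ∑ i ∈ Finset.range (K + 1), ∑ j ∈ Finset.range (M + 1),
      x (i + j + 2) * crossMinor y (K - i) (M - j) = x 0 * crossMinor y (K + 1) (M + 1) := by
  have h1 : ∑ i ∈ Finset.range (K + 1), ∑ j ∈ Finset.range (M + 1),
      x (i + j + 2) * (y (K - i) * delay y (M - j)) =
      ∑ i ∈ Finset.range (K + 1), ∑ j ∈ Finset.range (M + 1),
        x (i + j + 1) * y (K - i) * y (M - j) + x 0 * y (K + 1) * y M := by
    have : ∀ i ∈ Finset.range (K + 1), ∑ j ∈ Finset.range (M + 1),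
        x (i + j + 2) * (y (K - i) * delay y (M - j)) =
        ∑ j ∈ Finset.range (M + 1), x (i + j + 1) * y (K - i) * y (M - j) -
          x (i + 1) * y (K - i) * y M := by
      intro i _
      convert sum_mul_delay (fun j => x (i + j + 1) * y (K - i)) y M using 2 with j
      rw [show i + (j + 1) + 1 = i + j + 2 by ring]
      ring
    rw [Finset.sum_congr rfl this, Finset.sum_sub_distrib, ← Finset.sum_mul, h K]
    ring
  have h2 : ∑ i ∈ Finset.range (K + 1), ∑ j ∈ Finset.range (M + 1),
      x (i + j + 2) * (delay y (K - i) * y (M - j)) =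
      ∑ i ∈ Finset.range (K + 1), ∑ j ∈ Finset.range (M + 1),
        x (i + j + 1) * y (K - i) * y (M - j) + x 0 * y (M + 1) * y K := by
    rw [Finset.sum_comm, Finset.sum_comm (s := Finset.range (K + 1))]
    have : ∀ j ∈ Finset.range (M + 1), ∑ i ∈ Finset.range (K + 1),
        x (i + j + 2) * (delay y (K - i) * y (M - j)) =
        ∑ i ∈ Finset.range (K + 1), x (i + j + 1) * y (K - i) * y (M - j) -
          x (j + 1) * y (M - j) * y K := by
      intro j _
      convert sum_mul_delay (fun i => x (i + j + 1) * y (M - j)) y K using 2 with i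
      · rw [show i + 1 + j + 1 = i + j + 2 by ring]
        ring
      · exact Finset.sum_congr rfl fun i _ => by ring
      · rw [Nat.zero_add]
    rw [Finset.sum_congr rfl this, Finset.sum_sub_distrib, ← Finset.sum_mul, h M]
    ring
  simp only [crossMinor, mul_sub, Finset.sum_sub_distrib]
  rw [h1, h2]
  simp only [delay]
  ring

lemma crossMinor_mem_poleSpace (N p q : ℕ) (hp : p ≤ N) (hq : q ≤ N) :
    (fun a => crossMinor (fun k => taylor k a) p q) ∈ poleSpace (N + 1) := by
  induction N generalizing p q with
  | zero =>
    obtain rfl : p = 0 := by omega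
    obtain rfl : q = 0 := by omega
    exact poleSpace_congr (Submodule.zero_mem _) fun a _ => by simp [crossMinor, delay]
  | succ N ih =>
    rcases p with _ | K <;> rcases q with _ | M
    · exact poleSpace_congr (Submodule.zero_mem _) fun a _ => by simp [crossMinor, delay]
    · exact poleSpace_congr (mul_mem_poleSpace (taylor_mem_poleSpace 0)
        (poleSpace_mono (by omega : M + 1 ≤ N + 1) (taylor_mem_poleSpace M)) (by omega))
        fun a _ => by simp [crossMinor, delay]
    · exact poleSpace_congr (Submodule.neg_mem _ (mul_mem_poleSpace (taylor_mem_poleSpace 0)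
        (poleSpace_mono (by omega : K + 1 ≤ N + 1) (taylor_mem_poleSpace K)) (by omega)))
        fun a _ => by simp [crossMinor, delay, mul_comm]
    · have hsum : (∑ i ∈ Finset.range (K + 1), ∑ j ∈ Finset.range (M + 1), fun a =>
          taylor (i + j + 2) (iota a) * crossMinor (fun k => taylor k a) (K - i) (M - j)) ∈
          poleSpace (N + 1) := by
        refine Submodule.sum_mem _ fun i _ => Submodule.sum_mem _ fun j _ => ?_
        exact mul_mem_poleSpace (taylor_iota_mem_poleSpace _)
          (ih (K - i) (M - j) (by omega) (by omega)) (Nat.zero_add _)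
      refine poleSpace_congr (mul_mem_poleSpace value_mem_poleSpace hsum
        (Nat.add_comm 1 (N + 1))) fun a ha => ?_
      simp only [Finset.sum_apply]
      rw [sum_mul_crossMinor (x := fun k => taylor k (iota a)) (sum_iota_mul_taylor ha)]
      linear_combination -crossMinor (fun k => taylor k a) (K + 1) (M + 1) * taylor_zero_mul ha

lemma aeval_mem_of_forall_mem {R A σ : Type*} [CommSemiring R] [CommSemiring A] [Algebra R A]
    {S : Subalgebra R A} {f : σ → A} (hf : ∀ i, f i ∈ S) (p : MvPolynomial σ R) :
    aeval f p ∈ S := by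
  induction p using MvPolynomial.induction_on with
  | C c => simp
  | add p q hp hq => simpa using S.add_mem hp hq
  | mul_X p i hp => simpa using S.mul_mem hp (hf i)

/-- A polynomial in the jet of order below `n` whose pole order is at most `n` lies in `Sₙ`. -/
lemma mem_Sn_of_mem_poleSpace {n : ℕ} (hn : 0 < n) {ρ : MvPolynomial ℕ ℂ}
    (hρ : ρ ∈ supported ℂ (Set.Iio n)) (h : (fun a => eval a ρ) ∈ poleSpace n) :
    ρ ∈ Sn n := by
  obtain ⟨σ, hσ⟩ := h
  refine ⟨hρ, aeval (fun j => if j < n then X j else 0) σ,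
    aeval_mem_of_forall_mem (fun j => ?_) σ, fun a ha => ?_⟩
  · split_ifs with hj
    · exact X_mem_supported.mpr hj
    · exact Subalgebra.zero_mem _
  · obtain ⟨a', haa, hinv⟩ := exists_iota_truncated hn ha
    have h1 : eval a ρ = eval a' ρ :=
      eval₂Hom_congr' rfl (fun i hi _ => (haa i (mem_supported.mp hρ hi)).symm) rfl
    have h2 := hσ a' (by rwa [haa 0 hn])
    simp only at h2
    have hcomp : (eval (iota a)).comp (aeval (R := ℂ) (fun j : ℕ =>
        if j < n then (X j : MvPolynomial ℕ ℂ) else 0)).toRingHom =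
        eval (fun j => if j < n then iota a j else 0) := by
      refine ringHom_ext (fun c => by simp) fun j => ?_
      by_cases hj : j < n <;> simp [hj]
    rw [h1, h2, haa 0 hn, hinv, ← hcomp]
    rfl

/-- The span of the quadratic monomials in the variables of index below `n`. -/
noncomputable def quadSpan (n : ℕ) : Submodule ℂ (MvPolynomial ℕ ℂ) :=
  Submodule.span ℂ {p | ∃ i j : ℕ, i < n ∧ j < n ∧ p = X i * X j}

lemma mem_quadSpan {n : ℕ} {ρ : MvPolynomial ℕ ℂ} (hρ : ρ ∈ supported ℂ (Set.Iio n))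
    (h : ρ.IsHomogeneous 2) : ρ ∈ quadSpan n := by
  rw [as_sum ρ]
  refine Submodule.sum_mem _ fun d hd => ?_
  have hdeg : d.degree = 2 := by
    by_contra hne
    exact mem_support_iff.mp hd (h.coeff_eq_zero hne)
  have hcard : (Finsupp.toMultiset d).card = 2 := by
    rw [Finsupp.card_toMultiset, ← hdeg, Finsupp.degree_apply, Finsupp.sum]
    rfl
  obtain ⟨i, j, hij⟩ := Multiset.card_eq_two.mp hcard
  have hmem : ∀ k ∈ Finsupp.toMultiset d, k < n := by
    intro k hk
    exact mem_supported.mp hρ ((mem_vars_iff_mem_support k).mpr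
      ⟨d, hd, (Finsupp.mem_toMultiset d k).mp hk⟩)
  rw [hij] at hmem
  have hd' : d = Finsupp.single i 1 + Finsupp.single j 1 := by
    apply Multiset.toFinsupp.symm.injective
    simpa using hij
  have : monomial d (coeff d ρ) = coeff d ρ • (X i * X j : MvPolynomial ℕ ℂ) := by
    rw [X, X, monomial_mul, smul_monomial, ← hd']
    simp
  rw [this]
  exact Submodule.smul_mem _ _
    (Submodule.subset_span ⟨i, j, hmem i (by simp), hmem j (by simp), rfl⟩)

/-- The substitution of the geometric jet `x_j = j! u^j`. -/
noncomputable def geomEval : MvPolynomial ℕ ℂ →ₐ[ℂ] Polynomial ℂ :=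
  aeval fun j => Polynomial.C (j.factorial : ℂ) * Polynomial.X ^ j

lemma geomEval_X_mul_X (i j : ℕ) : geomEval (X i * X j) =
    Polynomial.C ((i.factorial : ℂ) * (j.factorial : ℂ)) * Polynomial.X ^ (i + j) := by
  simp only [geomEval, map_mul, aeval_X, pow_add]
  ring

lemma eval_geometric {n : ℕ} {ρ : MvPolynomial ℕ ℂ} (hρ : ρ ∈ quadSpan n) (s u : ℂ) :
    eval (fun j => (j.factorial : ℂ) * (s * u ^ j)) ρ = s ^ 2 * (geomEval ρ).eval u := by
  induction hρ using Submodule.span_induction with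
  | mem p hp =>
    obtain ⟨i, j, -, -, rfl⟩ := hp
    rw [geomEval_X_mul_X]
    simp only [map_mul, eval_X, Polynomial.eval_mul, Polynomial.eval_C, Polynomial.eval_pow,
      Polynomial.eval_X, pow_add]
    ring
  | zero => simp
  | add p q _ _ hp hq => simp [hp, hq, mul_add]
  | smul c p _ hp => simp [smul_eval, hp]; ring

lemma iota_geometric {s : ℂ} (hs : s ≠ 0) (u : ℂ) :
    iota (fun j => (j.factorial : ℂ) * (s * u ^ j)) =
      fun j => if j = 0 then s⁻¹ else if j = 1 then -(u * s⁻¹) else 0 := by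
  refine iota_eq_of_mul_eq_one (by simpa using hs) ?_
  have h1 : jetSeries (fun j => (j.factorial : ℂ) * (s * u ^ j)) =
      PowerSeries.mk fun j => s * u ^ j := by
    ext k
    have : (k.factorial : ℂ) ≠ 0 := by exact_mod_cast k.factorial_ne_zero
    simp [this]
  have h2 : jetSeries (fun j => if j = 0 then s⁻¹ else if j = 1 then -(u * s⁻¹) else 0) =
      PowerSeries.C s⁻¹ - PowerSeries.C (u * s⁻¹) * PowerSeries.X := by
    ext k
    rcases k with _ | _ | k
    · simp
    · simp [PowerSeries.coeff_C]
    · simp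
  rw [h1, h2]
  have h3 : ∀ A : PowerSeries ℂ,
      A * (PowerSeries.C s⁻¹ - PowerSeries.C (u * s⁻¹) * PowerSeries.X) =
      PowerSeries.C s⁻¹ * A - PowerSeries.C (u * s⁻¹) * (A * PowerSeries.X) := fun A => by ring
  ext k
  rw [h3, map_sub, PowerSeries.coeff_C_mul, PowerSeries.coeff_C_mul]
  rcases k with _ | k
  · simp [hs]
  · rw [PowerSeries.coeff_succ_mul_X, PowerSeries.coeff_one, if_neg k.succ_ne_zero,
      PowerSeries.coeff_mk, PowerSeries.coeff_mk, pow_succ]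
    ring

/-- The substitution `x_0 = z`, `x_1 = -u z`, `x_j = 0` for `j ≥ 2`. -/
noncomputable def affineEval : MvPolynomial ℕ ℂ →ₐ[ℂ] Polynomial (Polynomial ℂ) :=
  aeval fun j => if j = 0 then Polynomial.X else
    if j = 1 then Polynomial.C (-Polynomial.X) * Polynomial.X else 0

lemma natDegree_coeff_affineEval_le (σ : MvPolynomial ℕ ℂ) (e : ℕ) :
    ((affineEval σ).coeff e).natDegree ≤ e := by
  induction σ using MvPolynomial.induction_on generalizing e with
  | C c =>
    have : affineEval (C c) = Polynomial.C (Polynomial.C c) := by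
      simp [affineEval]
    rw [this, Polynomial.coeff_C]
    split_ifs <;> simp
  | add p q hp hq =>
    rw [map_add, Polynomial.coeff_add]
    exact Polynomial.natDegree_add_le_of_degree_le (hp e) (hq e)
  | mul_X p i hp =>
    have hX : affineEval (X i) = if i = 0 then Polynomial.X else
        if i = 1 then Polynomial.C (-Polynomial.X) * Polynomial.X else 0 := by
      simp [affineEval]
    rw [map_mul, hX]
    split_ifs
    · rcases e with _ | e
      · simp
      · rw [Polynomial.coeff_mul_X]
        exact (hp e).trans e.le_succ
    · rw [← mul_assoc]
      rcases e with _ | e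
      · simp
      · rw [Polynomial.coeff_mul_X, Polynomial.coeff_mul_C]
        exact Polynomial.natDegree_mul_le_of_le (hp e) (by simp)
    · simp

lemma eval_eval_affineEval (σ : MvPolynomial ℕ ℂ) (z u : ℂ) :
    ((affineEval σ).eval (Polynomial.C z)).eval u =
      eval (fun j => if j = 0 then z else if j = 1 then -u * z else 0) σ := by
  induction σ using MvPolynomial.induction_on with
  | C c =>
    have : affineEval (C c) = Polynomial.C (Polynomial.C c) := by
      simp [affineEval]
    simp [this]
  | add p q hp hq => simp [hp, hq]
  | mul_X p i hp =>
    rw [map_mul, Polynomial.eval_mul, Polynomial.eval_mul, hp, map_mul, eval_X]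
    congr 1
    simp only [affineEval, aeval_X]
    split_ifs
    · simp
    · simp only [Polynomial.eval_mul, Polynomial.eval_C, Polynomial.eval_X, Polynomial.eval_neg]
    · simp

lemma natDegree_geomEval_le {n : ℕ} (hn : 2 ≤ n) {ρ : MvPolynomial ℕ ℂ} (hρ : ρ ∈ Snd n 2) :
    (geomEval ρ).natDegree ≤ n - 2 := by
  obtain ⟨⟨hsupp, σ, -, hrel⟩, hhom⟩ := hρ
  have hquad := mem_quadSpan hsupp hhom
  have key : Polynomial.C (geomEval ρ) * Polynomial.X ^ (n - 2) = affineEval σ := by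
    apply Polynomial.eq_of_infinite_eval_eq
    have hinf : (Polynomial.C '' {z : ℂ | z ≠ 0}).Infinite :=
      (Set.infinite_of_finite_compl (by simp [Set.compl_ofPred])).image
        Polynomial.C_injective.injOn
    refine hinf.mono ?_
    rintro _ ⟨z, hz, rfl⟩
    have hz : z ≠ 0 := hz
    refine Polynomial.funext fun u => ?_
    rw [eval_eval_affineEval]
    have h := hrel (fun j => (j.factorial : ℂ) * (z⁻¹ * u ^ j)) (by simpa using hz)
    rw [eval_geometric hquad, iota_geometric (inv_ne_zero hz)] at h
    obtain ⟨m, rfl⟩ := Nat.exists_eq_add_of_le hn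
    simp only [inv_inv, Nat.factorial_zero, Nat.cast_one, pow_zero, mul_one, one_mul] at h
    simp only [Nat.add_sub_cancel_left, Polynomial.eval_mul, Polynomial.eval_C,
      Polynomial.eval_pow, Polynomial.eval_X]
    rw [pow_add, mul_assoc] at h
    have h' := mul_left_cancel₀ (pow_ne_zero 2 (inv_ne_zero hz)) h
    rw [h', inv_pow]
    field_simp
  have h := natDegree_coeff_affineEval_le σ (n - 2)
  rwa [← key, Polynomial.coeff_C_mul_X_pow, if_pos rfl] at h

lemma X_mul_X_mem_Sn {n r₁ r₂ : ℕ} (hn : 2 ≤ n) (hr : r₁ + r₂ ≤ n - 2) :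
    (X r₁ * X r₂ : MvPolynomial ℕ ℂ) ∈ Sn n := by
  refine mem_Sn_of_mem_poleSpace (by omega) (Subalgebra.mul_mem _
    (X_mem_supported.mpr (Set.mem_Iio.mpr (by omega)))
    (X_mem_supported.mpr (Set.mem_Iio.mpr (by omega)))) ?_
  have h := (poleSpace n).smul_mem ((r₁.factorial : ℂ) * r₂.factorial)
    (poleSpace_mono (by omega : r₁ + 1 + (r₂ + 1) ≤ n)
      (mul_mem_poleSpace (taylor_mem_poleSpace r₁) (taylor_mem_poleSpace r₂) rfl))
  refine poleSpace_congr h fun a _ => ?_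
  have h1 : (r₁.factorial : ℂ) ≠ 0 := by exact_mod_cast r₁.factorial_ne_zero
  have h2 : (r₂.factorial : ℂ) ≠ 0 := by exact_mod_cast r₂.factorial_ne_zero
  simp only [taylor, Pi.smul_apply, smul_eq_mul, map_mul, eval_X]
  field_simp

lemma binomial_mem_Sn {n k m : ℕ} (hk : k + 1 < n) (hm : m + 1 < n) :
    (X (k + 1) * X m - C (((k + 1 : ℕ) : ℂ) / ((m : ℂ) + 1)) * (X k * X (m + 1)) :
      MvPolynomial ℕ ℂ) ∈ Sn n := by
  have hX : ∀ i < n, (X i : MvPolynomial ℕ ℂ) ∈ supported ℂ (Set.Iio n) :=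
    fun i hi => X_mem_supported.mpr hi
  refine mem_Sn_of_mem_poleSpace (by omega) (Subalgebra.sub_mem _
    (Subalgebra.mul_mem _ (hX _ hk) (hX _ (by omega)))
    (Subalgebra.mul_mem _ (Subalgebra.algebraMap_mem _ _)
      (Subalgebra.mul_mem _ (hX _ (by omega)) (hX _ hm)))) ?_
  have h := (poleSpace n).smul_mem (((k + 1).factorial : ℂ) * m.factorial)
    (poleSpace_mono (by omega : n - 1 + 1 ≤ n)
      (crossMinor_mem_poleSpace (n - 1) (k + 1) (m + 1) (by omega) (by omega)))
  refine poleSpace_congr h fun a _ => ?_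
  have h1 : (k.factorial : ℂ) ≠ 0 := by exact_mod_cast k.factorial_ne_zero
  have h2 : (m.factorial : ℂ) ≠ 0 := by exact_mod_cast m.factorial_ne_zero
  have h3 : (k : ℂ) + 1 ≠ 0 := by exact_mod_cast k.succ_ne_zero
  have h4 : (m : ℂ) + 1 ≠ 0 := by exact_mod_cast m.succ_ne_zero
  simp only [crossMinor, delay, taylor, Pi.smul_apply, smul_eq_mul, map_mul, map_sub, eval_X,
    eval_C, Nat.factorial_succ, Nat.cast_mul, Nat.cast_add, Nat.cast_one]
  field_simp

/-- The variables rescaled to Taylor coefficients. -/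
noncomputable def taylorX (i : ℕ) : MvPolynomial ℕ ℂ := C ((i.factorial : ℂ)⁻¹) * X i

lemma X_mul_X_eq_smul_taylorX (i j : ℕ) : (X i * X j : MvPolynomial ℕ ℂ) =
    ((i.factorial : ℂ) * j.factorial) • (taylorX i * taylorX j) := by
  have h1 : (i.factorial : ℂ) ≠ 0 := by exact_mod_cast i.factorial_ne_zero
  have h2 : (j.factorial : ℂ) ≠ 0 := by exact_mod_cast j.factorial_ne_zero
  have h : (C ((i.factorial : ℂ) * j.factorial) * (C (i.factorial : ℂ)⁻¹ * C (j.factorial : ℂ)⁻¹)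
      : MvPolynomial ℕ ℂ) = 1 := by
    rw [← C_mul, ← C_mul, ← C_1]
    congr 1
    field_simp
  rw [smul_eq_C_mul, taylorX, taylorX]
  linear_combination -(X i * X j) * h

lemma taylorX_mul_taylorX (i j : ℕ) : taylorX i * taylorX j =
    ((i.factorial : ℂ)⁻¹ * (j.factorial : ℂ)⁻¹) • (X i * X j : MvPolynomial ℕ ℂ) := by
  rw [smul_eq_C_mul, taylorX, taylorX, C_mul]
  ring

lemma taylorX_binomial (k m : ℕ) :
    taylorX (k + 1) * taylorX m - taylorX k * taylorX (m + 1) =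
      (((k + 1).factorial : ℂ)⁻¹ * (m.factorial : ℂ)⁻¹) •
        (X (k + 1) * X m - C (((k + 1 : ℕ) : ℂ) / ((m : ℂ) + 1)) * (X k * X (m + 1))) := by
  rw [taylorX_mul_taylorX, taylorX_mul_taylorX, smul_sub, ← smul_eq_C_mul, smul_smul]
  congr 2
  have h1 : (k.factorial : ℂ) ≠ 0 := by exact_mod_cast k.factorial_ne_zero
  have h3 : (k : ℂ) + 1 ≠ 0 := by exact_mod_cast k.succ_ne_zero
  have h4 : (m : ℂ) + 1 ≠ 0 := by exact_mod_cast m.succ_ne_zero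
  simp only [Nat.factorial_succ, Nat.cast_mul, Nat.cast_add, Nat.cast_one]
  field_simp

/-- The basis of `S_{n,2}`, indexed by the pairs `j < i < n`. -/
noncomputable def basisFamily (n : ℕ) (x : Σ _ : ℕ, ℕ) : MvPolynomial ℕ ℂ :=
  if x.1 + x.2 < n then X (x.1 - 1) * X x.2
  else X x.1 * X (x.2 - 1) - C ((x.1 : ℂ) / x.2) * (X (x.1 - 1) * X x.2)

/-- The pairs `j < i < n`. -/
def basisIndex (n : ℕ) : Finset (Σ _ : ℕ, ℕ) :=
  (Finset.range n).sigma fun i => Finset.range i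

lemma mem_basisIndex {n : ℕ} {x : Σ _ : ℕ, ℕ} :
    x ∈ basisIndex n ↔ x.1 < n ∧ x.2 < x.1 := by
  simp [basisIndex]

lemma card_basisIndex (n : ℕ) : (basisIndex n).card = n * (n - 1) / 2 := by
  simp [basisIndex, Finset.sum_range_id]

lemma image_basisFamily {n : ℕ} (hn : 2 ≤ n) :
    {p : MvPolynomial ℕ ℂ | ∃ r₁ r₂ : ℕ, r₂ ≤ r₁ ∧ r₁ + r₂ ≤ n - 2 ∧ p = X r₁ * X r₂} ∪
      {p | ∃ k₁ k₂ : ℕ, k₁ ≤ n - 1 ∧ n - 1 ≤ k₁ + k₂ ∧ k₂ + 2 ≤ k₁ ∧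
        p = X k₁ * X k₂ - C ((k₁ : ℂ) / ((k₂ : ℂ) + 1)) * (X (k₁ - 1) * X (k₂ + 1))} =
    basisFamily n '' (basisIndex n : Set (Σ _ : ℕ, ℕ)) := by
  ext p
  constructor
  · rintro (⟨r₁, r₂, h1, h2, rfl⟩ | ⟨k₁, k₂, h1, h2, h3, rfl⟩)
    · refine ⟨⟨r₁ + 1, r₂⟩, mem_basisIndex.mpr ⟨?_, ?_⟩, ?_⟩
      · simp only; omega
      · simp only; omega
      · rw [basisFamily, if_pos (by simp only; omega)]
        rfl
    · refine ⟨⟨k₁, k₂ + 1⟩, mem_basisIndex.mpr ⟨?_, ?_⟩, ?_⟩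
      · simp only; omega
      · simp only; omega
      · rw [basisFamily, if_neg (by simp only; omega)]
        simp
  · rintro ⟨⟨i, j⟩, hx, rfl⟩
    obtain ⟨hi, hj⟩ := mem_basisIndex.mp hx
    simp only at hi hj
    by_cases h : i + j < n
    · exact Or.inl ⟨i - 1, j, by omega, by omega, by rw [basisFamily, if_pos h]⟩
    · obtain ⟨j, rfl⟩ := Nat.exists_eq_add_of_le' (by omega : 1 ≤ j)
      exact Or.inr ⟨i, j, by omega, by omega, by omega, by
        rw [basisFamily, if_neg h]
        simp⟩

lemma coeff_X_mul_X {R : Type*} [CommSemiring R] (p q i j : ℕ) :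
    coeff (Finsupp.single p 1 + Finsupp.single q 1) (X i * X j : MvPolynomial ℕ R) =
      if (i = p ∧ j = q) ∨ (i = q ∧ j = p) then 1 else 0 := by
  rw [X, X, monomial_mul, coeff_monomial, mul_one]
  congr 1
  rw [Finsupp.single_add_single_eq_single_add_single one_ne_zero one_ne_zero]
  simp

lemma linearIndepOn_basisFamily (n : ℕ) :
    LinearIndepOn ℂ (basisFamily n) (basisIndex n : Set (Σ _ : ℕ, ℕ)) := by
  rw [linearIndepOn_finset_iff]
  intro f hf x hx
  induction hd : x.1 - x.2 using Nat.strong_induction_on generalizing x with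
  | _ d ih =>
    obtain ⟨i, j⟩ := x
    obtain ⟨hi, hj⟩ := mem_basisIndex.mp hx
    simp only at hi hj hd
    obtain ⟨i, rfl⟩ := Nat.exists_eq_add_of_le' (by omega : 1 ≤ i)
    have h := congrArg (coeff (Finsupp.single i 1 + Finsupp.single j 1)) hf
    rw [coeff_sum, coeff_zero, Finset.sum_eq_single_of_mem _ hx] at h
    · have hne : coeff (Finsupp.single i 1 + Finsupp.single j 1)
          (basisFamily n ⟨i + 1, j⟩) ≠ 0 := by
        by_cases hlt : i + 1 + j < n
        · simp [basisFamily, hlt]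
        · have hj0 : j ≠ 0 := by omega
          have h1 : (i : ℂ) + 1 ≠ 0 := by exact_mod_cast i.succ_ne_zero
          have h2 : ¬ (i + 1 = j ∧ j - 1 = i) := by omega
          simp [basisFamily, hlt, coeff_X_mul_X, coeff_C_mul, hj0, h1, h2]
      rw [coeff_smul, smul_eq_mul] at h
      exact (mul_eq_zero.mp h).resolve_right hne
    · rintro ⟨i', j'⟩ hx' hxx
      obtain ⟨hi', hj'⟩ := mem_basisIndex.mp hx'
      simp only at hi' hj'
      have hne : ¬ (i' = i + 1 ∧ j' = j) := by
        rintro ⟨rfl, rfl⟩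
        exact hxx rfl
      rw [coeff_smul, smul_eq_mul]
      by_cases hlow : i' = i ∧ j' = j + 1
      · rw [ih (i' - j') (by omega) _ hx' rfl, zero_mul]
      · have h1 : ¬ ((i' - 1 = i ∧ j' = j) ∨ (i' - 1 = j ∧ j' = i)) := by omega
        by_cases hlt : i' + j' < n
        · simp [basisFamily, hlt, coeff_X_mul_X, h1]
        · have h2 : ¬ ((i' = i ∧ j' - 1 = j) ∨ (i' = j ∧ j' - 1 = i)) := by omega
          simp [basisFamily, hlt, coeff_X_mul_X, coeff_C_mul, h1, h2]

lemma isHomogeneous_X_mul_X (i j : ℕ) : (X i * X j : MvPolynomial ℕ ℂ).IsHomogeneous 2 :=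
  (isHomogeneous_X ℂ i).mul (isHomogeneous_X ℂ j)

lemma isWeightedHomogeneous_X_mul_X {i j l : ℕ} (h : i + j = l) :
    IsWeightedHomogeneous (fun i : ℕ => i) (X i * X j : MvPolynomial ℕ ℂ) l :=
  h ▸ (isWeightedHomogeneous_X ℂ (fun i : ℕ => i) i).mul
    (isWeightedHomogeneous_X ℂ (fun i : ℕ => i) j)

lemma basisFamily_mem_Sndl {n : ℕ} (hn : 2 ≤ n) {x : Σ _ : ℕ, ℕ} (hx : x ∈ basisIndex n) :
    basisFamily n x ∈ Sndl n 2 (x.1 + x.2 - 1) := by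
  obtain ⟨i, j⟩ := x
  obtain ⟨hi, hj⟩ := mem_basisIndex.mp hx
  simp only at hi hj
  by_cases h : i + j < n
  · simp only [basisFamily, if_pos h]
    exact ⟨⟨X_mul_X_mem_Sn hn (by omega), isHomogeneous_X_mul_X _ _⟩,
      isWeightedHomogeneous_X_mul_X (by omega)⟩
  · obtain ⟨i, rfl⟩ := Nat.exists_eq_add_of_le' (by omega : 1 ≤ i)
    obtain ⟨j, rfl⟩ := Nat.exists_eq_add_of_le' (by omega : 1 ≤ j)
    simp only [basisFamily, if_neg h, Nat.add_sub_cancel]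
    refine ⟨⟨?_, (isHomogeneous_X_mul_X _ _).sub ((isHomogeneous_X_mul_X _ _).C_mul _)⟩, ?_⟩
    · have := binomial_mem_Sn (n := n) (k := i) (m := j) (by omega) (by omega)
      rwa [Nat.cast_add j 1, Nat.cast_one]
    · refine Submodule.sub_mem _ (isWeightedHomogeneous_X_mul_X (by omega)) ?_
      rw [← smul_eq_C_mul]
      exact Submodule.smul_mem _ _ (isWeightedHomogeneous_X_mul_X (by omega))

/-- In weight at least `n - 1`, all normalized quadratic monomials agree modulo the span of the
basis. -/
lemma taylorX_sub_mem_span {n i j : ℕ} (hi : i < n) (hji : j ≤ i) (hij : n - 1 ≤ i + j) :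
    taylorX i * taylorX j - taylorX (n - 1) * taylorX (i + j - (n - 1)) ∈
      Submodule.span ℂ (basisFamily n '' (basisIndex n : Set (Σ _ : ℕ, ℕ))) := by
  obtain ⟨d, hd⟩ := Nat.exists_eq_add_of_le (by omega : i ≤ n - 1)
  induction d generalizing i j with
  | zero =>
    obtain rfl : i = n - 1 := by omega
    simp
  | succ d ih =>
    obtain ⟨j, rfl⟩ := Nat.exists_eq_add_of_le' (by omega : 1 ≤ j)
    have h := ih (i := i + 1) (j := j) (by omega) (by omega) (by omega) (by omega)
    have hb : taylorX (i + 1) * taylorX j - taylorX i * taylorX (j + 1) ∈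
        Submodule.span ℂ (basisFamily n '' (basisIndex n : Set (Σ _ : ℕ, ℕ))) := by
      rw [taylorX_binomial]
      refine Submodule.smul_mem _ _ (Submodule.subset_span ⟨⟨i + 1, j + 1⟩,
        mem_basisIndex.mpr ⟨?_, ?_⟩, ?_⟩)
      · simp only; omega
      · simp only; omega
      · rw [basisFamily, if_neg (by simp only; omega)]
        simp
    convert Submodule.sub_mem _ h hb using 1
    rw [show i + 1 + j = i + (j + 1) by ring]
    ring

lemma sub_sum_coeff_geomEval_mem_span {n : ℕ} (hn : 2 ≤ n) {ρ : MvPolynomial ℕ ℂ}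
    (hρ : ρ ∈ quadSpan n) :
    ρ - ∑ l ∈ Finset.Ico (n - 1) (2 * n),
        (geomEval ρ).coeff l • (taylorX (n - 1) * taylorX (l - (n - 1))) ∈
      Submodule.span ℂ (basisFamily n '' (basisIndex n : Set (Σ _ : ℕ, ℕ))) := by
  induction hρ using Submodule.span_induction with
  | mem p hp =>
    obtain ⟨i, j, hi, hj, rfl⟩ := hp
    wlog hji : j ≤ i generalizing i j
    · rw [mul_comm]
      exact this j i hj hi (by omega)
    simp only [geomEval_X_mul_X, Polynomial.coeff_C_mul_X_pow, ite_smul, zero_smul]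
    rw [Finset.sum_ite_eq']
    split_ifs with hmem
    · rw [X_mul_X_eq_smul_taylorX, ← smul_sub]
      exact Submodule.smul_mem _ _ (taylorX_sub_mem_span hi hji (Finset.mem_Ico.mp hmem).1)
    · rw [sub_zero]
      have hlt : i + j < n - 1 := by
        by_contra hge
        exact hmem (Finset.mem_Ico.mpr ⟨by omega, by omega⟩)
      refine Submodule.subset_span ⟨⟨i + 1, j⟩, mem_basisIndex.mpr ⟨?_, ?_⟩, ?_⟩
      · simp only; omega
      · simp only; omega
      · rw [basisFamily, if_pos (by simp only; omega)]
        rfl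
  | zero => simp
  | add p q _ _ hp hq =>
    convert Submodule.add_mem _ hp hq using 1
    simp only [map_add, Polynomial.coeff_add, add_smul, Finset.sum_add_distrib]
    ring
  | smul c p _ hp =>
    convert Submodule.smul_mem _ c hp using 1
    simp only [map_smul, Polynomial.coeff_smul, smul_assoc, smul_sub, Finset.smul_sum]

lemma span_basisFamily {n : ℕ} (hn : 2 ≤ n) :
    Submodule.span ℂ (basisFamily n '' (basisIndex n : Set (Σ _ : ℕ, ℕ))) = Snd n 2 := by
  apply le_antisymm
  · rw [Submodule.span_le]
    rintro _ ⟨x, hx, rfl⟩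
    exact (basisFamily_mem_Sndl hn hx).1
  · intro ρ hρ
    have h := sub_sum_coeff_geomEval_mem_span hn (mem_quadSpan hρ.1.1 hρ.2)
    rwa [Finset.sum_eq_zero, sub_zero] at h
    intro l hl
    have hl := (Finset.mem_Ico.mp hl).1
    rw [Polynomial.coeff_eq_zero_of_natDegree_lt, zero_smul]
    exact (natDegree_geomEval_le hn hρ).trans_lt (by omega)

lemma disjoint_Sndl (n d l : ℕ) (s : Set ℕ) (hl : l ∉ s) :
    Disjoint (Sndl n d l) (⨆ l' ∈ s, Sndl n d l') := by
  rw [Submodule.disjoint_def]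
  intro p hp hp'
  have hle : (⨆ l' ∈ s, Sndl n d l') ≤
      LinearMap.ker (weightedHomogeneousComponent (R := ℂ) (fun i : ℕ => i) l) := by
    refine iSup₂_le fun l' hl' q hq => ?_
    exact IsWeightedHomogeneous.weightedHomogeneousComponent_ne l hq.2
      fun h => hl (h ▸ hl')
  rw [← IsWeightedHomogeneous.weightedHomogeneousComponent_same hp.2]
  exact hle hp'

lemma Snd_le_iSup_Sndl {n : ℕ} (hn : 2 ≤ n) :
    Snd n 2 ≤ ⨆ l ∈ Set.Iic (2 * n - 4), Sndl n 2 l := by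
  rw [← span_basisFamily hn, Submodule.span_le]
  rintro _ ⟨x, hx, rfl⟩
  obtain ⟨h1, h2⟩ := mem_basisIndex.mp hx
  have hle : x.1 + x.2 - 1 ∈ Set.Iic (2 * n - 4) := Set.mem_Iic.mpr (by omega)
  exact le_iSup₂ (f := fun l (_ : l ∈ Set.Iic (2 * n - 4)) => Sndl n 2 l) _ hle
    (basisFamily_mem_Sndl hn hx)

/-- **Theorem 1.1.** Let `n ≥ 2`. The set consisting of the monomials `x_{r₁} x_{r₂}`
(`0 ≤ r₂ ≤ r₁ ≤ n−2−r₂`) together with the binomials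
`x_{k₁} x_{k₂} − (k₁/(k₂+1)) x_{k₁−1} x_{k₂+1}` (`0 ≤ n−1−k₁ ≤ k₂ ≤ k₁−2`) is a basis of
`S_{n,2}`. In particular `S_{n,2} = ⊕_{l=0}^{2n−4} S_{n,2,l}` and
`dim S_{n,2} = n(n−1)/2`. -/
theorem stmt0 (n : ℕ) (hn : 2 ≤ n)
    (B : Set (MvPolynomial ℕ ℂ))
    (hB : B = {p | ∃ r₁ r₂ : ℕ, r₂ ≤ r₁ ∧ r₁ + r₂ ≤ n - 2 ∧ p = X r₁ * X r₂} ∪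
      {p | ∃ k₁ k₂ : ℕ, k₁ ≤ n - 1 ∧ n - 1 ≤ k₁ + k₂ ∧ k₂ + 2 ≤ k₁ ∧
        p = X k₁ * X k₂ - C ((k₁ : ℂ) / ((k₂ : ℂ) + 1)) * (X (k₁ - 1) * X (k₂ + 1))}) :
    LinearIndependent ℂ ((↑) : B → MvPolynomial ℕ ℂ) ∧
    Submodule.span ℂ B = Snd n 2 ∧
    (Snd n 2 = ⨆ l ∈ Set.Iic (2 * n - 4), Sndl n 2 l) ∧
    (∀ l ∈ Set.Iic (2 * n - 4),
      Disjoint (Sndl n 2 l) (⨆ l' ∈ Set.Iic (2 * n - 4) \ {l}, Sndl n 2 l')) ∧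
    Module.finrank ℂ ↥(Snd n 2) = n * (n - 1) / 2 := by
  rw [image_basisFamily hn] at hB
  subst hB
  have hind := linearIndepOn_basisFamily n
  have hspan := span_basisFamily hn
  refine ⟨hind.id_image, hspan, le_antisymm (Snd_le_iSup_Sndl hn)
    (iSup₂_le fun l _ => inf_le_left), fun l _ => disjoint_Sndl n 2 l _ fun h => h.2 rfl, ?_⟩
  have hcard := finrank_span_eq_card hind
  rw [← Set.image_eq_range, hspan] at hcard
  rw [hcard, ← card_basisIndex]
  exact Fintype.card_coe (basisIndex n)
end

section
/- Let n ≥ 2 be an integer. Then dim S_{n,2,l} = 1 + ⌊l/2⌋ for 0 ≤ l ≤ n−2, and dim S_{n,2,l} = 1 + ⌊(2n−4−l)/2⌋ for n−1 ≤ l ≤ 2n−4. In particular, 1 ≤ dim S_{n,2,l} ≤ ⌊n/2⌋ for all 0 ≤ l ≤ 2n−4. -/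
open MvPolynomial

/-- The `j`-th Taylor coefficient of the reciprocal of the function with jet `a`. -/
noncomputable def invTaylor (j : ℕ) (a : ℕ → ℂ) : ℂ := iota a j / (j.factorial : ℂ)

lemma invTaylor_zero (a : ℕ → ℂ) : invTaylor 0 a = 1 / a 0 := by simp [invTaylor, iota_zero]

lemma mul_invTaylor_succ {a : ℕ → ℂ} (ha : a 0 ≠ 0) (m : ℕ) :
    a 0 * invTaylor (m + 1) a = -∑ k ∈ Finset.range (m + 1),
      a (k + 1) / ((k + 1).factorial : ℂ) * invTaylor (m - k) a := by
  rw [invTaylor, iota, mul_div_assoc', ← mul_assoc, mul_neg, mul_one_div_cancel ha, neg_one_mul,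
    neg_div, Finset.sum_div]
  congr 1
  refine Finset.sum_congr rfl fun k hk => ?_
  have hk' : k + 1 ≤ m + 1 := by simpa using hk
  have h := Nat.choose_mul_factorial_mul_factorial hk'
  rw [Nat.add_sub_add_right] at h
  have h' : ((m + 1).choose (k + 1) : ℂ) * ((k + 1).factorial : ℂ) * ((m - k).factorial : ℂ)
      = ((m + 1).factorial : ℂ) := by exact_mod_cast h
  have h1 : ((k + 1).factorial : ℂ) ≠ 0 := by exact_mod_cast (k + 1).factorial_ne_zero
  have h2 : ((m - k).factorial : ℂ) ≠ 0 := by exact_mod_cast (m - k).factorial_ne_zero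
  have h3 : ((m + 1).factorial : ℂ) ≠ 0 := by exact_mod_cast (m + 1).factorial_ne_zero
  rw [invTaylor]
  field_simp
  rw [← h']
  ring

lemma mk_mul_mk_invTaylor {a : ℕ → ℂ} (ha : a 0 ≠ 0) :
    PowerSeries.mk (fun j => a j / (j.factorial : ℂ)) *
      PowerSeries.mk (fun j => invTaylor j a) = 1 := by
  ext m
  rw [PowerSeries.coeff_mul, Finset.Nat.sum_antidiagonal_eq_sum_range_succ_mk,
    PowerSeries.coeff_one]
  simp only [PowerSeries.coeff_mk]
  cases m with
  | zero => simp [invTaylor_zero, ha]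
  | succ m =>
    rw [Finset.sum_range_succ']
    have h := mul_invTaylor_succ ha m
    simp only [Nat.add_sub_add_right, Nat.factorial_zero, Nat.cast_one, div_one, Nat.sub_zero]
    rw [h]
    simp

lemma iota_iota {a : ℕ → ℂ} (ha : a 0 ≠ 0) : iota (iota a) = a := by
  have hb : iota a 0 ≠ 0 := by simpa [iota_zero] using ha
  have h1 := mk_mul_mk_invTaylor ha
  have h2 := mk_mul_mk_invTaylor hb
  have h : PowerSeries.mk (fun j => invTaylor j (iota a)) =
      PowerSeries.mk (fun j => a j / (j.factorial : ℂ)) := by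
    refine (left_inv_eq_right_inv ?_ h2).symm
    exact h1
  ext j
  have hj := congrArg (PowerSeries.coeff j) h
  have hf : (j.factorial : ℂ) ≠ 0 := by exact_mod_cast j.factorial_ne_zero
  simpa [invTaylor, div_left_inj' hf] using hj

/-- The functions `g` of a jet `a` such that `(a 0) ^ k * g a` is a polynomial in
`a 0, …, a (n - 1)` on the set where `a 0 ≠ 0`. -/
def poleLE (n k : ℕ) : Submodule ℂ ((ℕ → ℂ) → ℂ) where
  carrier := {g | ∃ P ∈ supported ℂ (Set.Iio n), ∀ a : ℕ → ℂ, a 0 ≠ 0 →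
    a 0 ^ k * g a = eval a P}
  add_mem' := by
    rintro g h ⟨P, hP, hgP⟩ ⟨Q, hQ, hhQ⟩
    refine ⟨P + Q, add_mem hP hQ, fun a ha => ?_⟩
    rw [map_add, ← hgP a ha, ← hhQ a ha, Pi.add_apply, mul_add]
  zero_mem' := ⟨0, zero_mem _, fun a _ => by simp⟩
  smul_mem' := by
    rintro c g ⟨P, hP, hgP⟩
    refine ⟨c • P, Subalgebra.smul_mem _ hP c, fun a ha => ?_⟩
    rw [smul_eval, ← hgP a ha, Pi.smul_apply, smul_eq_mul, mul_left_comm]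

lemma X_mem_supported_Iio {n i : ℕ} (hi : i < n) :
    (X i : MvPolynomial ℕ ℂ) ∈ supported ℂ (Set.Iio n) :=
  X_mem_supported.2 hi

lemma poleLE_mono {n k m : ℕ} (hn : 0 < n) (hkm : k ≤ m) : poleLE n k ≤ poleLE n m := by
  rintro g ⟨P, hP, hgP⟩
  refine ⟨X 0 ^ (m - k) * P, mul_mem (pow_mem (X_mem_supported_Iio hn) _) hP, fun a ha => ?_⟩
  rw [map_mul, map_pow, eval_X, ← hgP a ha, ← mul_assoc, ← pow_add, Nat.sub_add_cancel hkm]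

lemma mul_mem_poleLE {n k m : ℕ} {g h : (ℕ → ℂ) → ℂ} (hg : g ∈ poleLE n k)
    (hh : h ∈ poleLE n m) : g * h ∈ poleLE n (k + m) := by
  obtain ⟨P, hP, hgP⟩ := hg
  obtain ⟨Q, hQ, hhQ⟩ := hh
  refine ⟨P * Q, mul_mem hP hQ, fun a ha => ?_⟩
  rw [map_mul, ← hgP a ha, ← hhQ a ha, Pi.mul_apply, pow_add]
  ring

lemma coord_mul_mem_poleLE {n k i : ℕ} (hi : i < n) {g : (ℕ → ℂ) → ℂ} (hg : g ∈ poleLE n k) :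
    (fun a => a i / (i.factorial : ℂ) * g a) ∈ poleLE n k := by
  obtain ⟨P, hP, hgP⟩ := hg
  refine ⟨(i.factorial : ℂ)⁻¹ • (X i * P),
    Subalgebra.smul_mem _ (mul_mem (X_mem_supported_Iio hi) hP) _, fun a ha => ?_⟩
  rw [smul_eval, map_mul, eval_X, ← hgP a ha]
  ring

lemma mem_poleLE_succ {n k : ℕ} {g h : (ℕ → ℂ) → ℂ} (hg : g ∈ poleLE n k)
    (hgh : ∀ a : ℕ → ℂ, a 0 ≠ 0 → a 0 * h a = g a) : h ∈ poleLE n (k + 1) := by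
  obtain ⟨P, hP, hgP⟩ := hg
  refine ⟨P, hP, fun a ha => ?_⟩
  rw [← hgP a ha, ← hgh a ha, pow_succ, mul_assoc]

lemma invTaylor_mem_poleLE {n j : ℕ} (hj : j < n) : invTaylor j ∈ poleLE n (j + 1) := by
  induction j using Nat.strong_induction_on with
  | _ j ih =>
    cases j with
    | zero =>
      refine ⟨1, one_mem _, fun a ha => ?_⟩
      simp [invTaylor_zero, ha]
    | succ m =>
      refine mem_poleLE_succ (g := -∑ k ∈ Finset.range (m + 1),
        fun a => a (k + 1) / ((k + 1).factorial : ℂ) * invTaylor (m - k) a) ?_ ?_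
      · refine neg_mem (sum_mem fun k hk => ?_)
        have hk' := Finset.mem_range.1 hk
        exact coord_mul_mem_poleLE (by omega)
          (poleLE_mono (by omega) (by omega) (ih (m - k) (by omega) (by omega)))
      · intro a ha
        rw [mul_invTaylor_succ ha, Pi.neg_apply, Finset.sum_apply]

/-- The two by two minors of the Toeplitz matrix of Taylor coefficients of the reciprocal. -/
noncomputable def invMinor (i j : ℕ) : (ℕ → ℂ) → ℂ :=
  invTaylor i * invTaylor (j + 1) - invTaylor (i + 1) * invTaylor j

lemma invMinor_swap (i j : ℕ) : invMinor i j = -invMinor j i := by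
  simp only [invMinor]; ring

lemma mul_invMinor_succ {a : ℕ → ℂ} (ha : a 0 ≠ 0) (i j : ℕ) :
    a 0 * invMinor i (j + 1) a =
      -(∑ k ∈ Finset.range (j + 1),
          a (k + 1) / ((k + 1).factorial : ℂ) * invMinor i (j - k) a +
        a (j + 2) / ((j + 2).factorial : ℂ) * (invTaylor i * invTaylor 0) a) := by
  have h1 := mul_invTaylor_succ ha (j + 1)
  have h2 := mul_invTaylor_succ ha j
  rw [Finset.sum_range_succ, Nat.sub_self] at h1
  have h3 : ∑ k ∈ Finset.range (j + 1),
      a (k + 1) / ((k + 1).factorial : ℂ) * invMinor i (j - k) a =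
      invTaylor i a * ∑ k ∈ Finset.range (j + 1),
        a (k + 1) / ((k + 1).factorial : ℂ) * invTaylor (j + 1 - k) a -
      invTaylor (i + 1) a * ∑ k ∈ Finset.range (j + 1),
        a (k + 1) / ((k + 1).factorial : ℂ) * invTaylor (j - k) a := by
    rw [Finset.mul_sum, Finset.mul_sum, ← Finset.sum_sub_distrib]
    refine Finset.sum_congr rfl fun k hk => ?_
    have hk' := Finset.mem_range.1 hk
    rw [show j + 1 - k = j - k + 1 by omega]
    simp only [invMinor, Pi.sub_apply, Pi.mul_apply]
    ring
  rw [h3]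
  simp only [invMinor, Pi.sub_apply, Pi.mul_apply]
  linear_combination invTaylor i a * h1 - invTaylor (i + 1) a * h2

lemma invMinor_mem_poleLE {n i j : ℕ} (hij : i ≤ j) (hj : j + 1 < n) :
    invMinor i j ∈ poleLE n (j + 2) := by
  induction j using Nat.strong_induction_on generalizing i with
  | _ j ih =>
    rcases hij.eq_or_lt with rfl | hlt
    · rw [show invMinor i i = 0 by rw [invMinor]; ring]
      exact zero_mem _
    obtain ⟨j, rfl⟩ : ∃ m, j = m + 1 := ⟨j - 1, by omega⟩
    refine mem_poleLE_succ (g := -((∑ k ∈ Finset.range (j + 1),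
        fun a => a (k + 1) / ((k + 1).factorial : ℂ) * invMinor i (j - k) a) +
        fun a => a (j + 2) / ((j + 2).factorial : ℂ) * (invTaylor i * invTaylor 0) a)) ?_ ?_
    · refine neg_mem (add_mem (sum_mem fun k hk => ?_) ?_)
      · have hk' := Finset.mem_range.1 hk
        refine coord_mul_mem_poleLE (by omega) ?_
        rcases le_total i (j - k) with h | h
        · exact poleLE_mono (by omega) (by omega) (ih (j - k) (by omega) h (by omega))
        · rw [invMinor_swap]
          exact neg_mem (poleLE_mono (by omega) (by omega) (ih i (by omega) h (by omega)))
      · exact coord_mul_mem_poleLE (by omega) (poleLE_mono (by omega) (by omega)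
          (mul_mem_poleLE (invTaylor_mem_poleLE (by omega)) (invTaylor_mem_poleLE (by omega))))
    · intro a ha
      rw [mul_invMinor_succ ha, Pi.neg_apply, Pi.add_apply, Finset.sum_apply]

lemma invTaylor_mul_sub_mem_poleLE {n l i₀ i : ℕ} (h₀ : l + 1 ≤ i₀ + n) (h : i₀ ≤ i)
    (hi : i ≤ l / 2) :
    invTaylor i * invTaylor (l - i) - invTaylor i₀ * invTaylor (l - i₀) ∈ poleLE n n := by
  induction i, h using Nat.le_induction with
  | base => simp
  | succ i h ih =>
    have hm : invMinor i (l - (i + 1)) ∈ poleLE n n :=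
      poleLE_mono (by omega) (by omega) (invMinor_mem_poleLE (n := n) (by omega) (by omega))
    have := sub_mem (ih (by omega)) hm
    rw [invMinor, show l - (i + 1) + 1 = l - i by omega] at this
    convert this using 1
    ring

lemma invTaylor_linear (ε : ℂ) (hε : ε ≠ 0) (j : ℕ) :
    invTaylor j (fun i => if i = 0 then ε else if i = 1 then 1 else 0) = (-1) ^ j / ε ^ (j + 1) := by
  induction j with
  | zero => simp [invTaylor_zero]
  | succ m ih =>
    have h := mul_invTaylor_succ
      (a := fun i => if i = 0 then ε else if i = 1 then 1 else 0) (by simpa using hε) m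
    rw [Finset.sum_range_succ', Finset.sum_eq_zero (by simp)] at h
    simp only [if_true, Nat.sub_zero, ih] at h
    norm_num at h
    rw [← mul_right_inj' hε, h]
    field_simp
    ring

lemma eq_zero_of_forall_mul_pow_eq {c : ℂ} {m n : ℕ} (hmn : n < m) (Q : Polynomial ℂ)
    (h : ∀ ε : ℂ, ε ≠ 0 → ε ^ n * (c / ε ^ m) = Q.eval ε) : c = 0 := by
  have hQ : Polynomial.C c = Q * Polynomial.X ^ (m - n) := by
    refine Polynomial.eq_of_infinite_eval_eq _ _ ((Set.finite_singleton (0 : ℂ)).infinite_compl.mono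
      fun ε hε => ?_)
    have hε' : ε ≠ 0 := hε
    simp only [Set.mem_ofPred_eq, Polynomial.eval_C, Polynomial.eval_mul, Polynomial.eval_pow,
      Polynomial.eval_X]
    rw [← h ε hε', mul_right_comm, ← pow_add, Nat.add_sub_cancel' hmn.le]
    field_simp
  have := congrArg (Polynomial.eval 0) hQ
  simpa [Nat.sub_ne_zero_of_lt hmn] using this

lemma mem_Sn_iff {n : ℕ} {ρ : MvPolynomial ℕ ℂ} :
    ρ ∈ Sn n ↔ ρ ∈ supported ℂ (Set.Iio n) ∧ (fun a => eval (iota a) ρ) ∈ poleLE n n := by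
  refine and_congr_right fun _ => exists_congr fun P => and_congr_right fun _ =>
    ⟨fun h a ha => ?_, fun h a ha => ?_⟩
  · have hb : iota a 0 ≠ 0 := by simpa [iota_zero] using ha
    dsimp only
    rw [h _ hb, iota_iota ha, iota_zero, ← mul_assoc, ← mul_pow, mul_one_div_cancel ha, one_pow,
      one_mul]
  · have hb : iota a 0 ≠ 0 := by simpa [iota_zero] using ha
    have h' := h _ hb
    dsimp only at h'
    rw [iota_iota ha] at h'
    rw [← h', iota_zero, ← mul_assoc, ← mul_pow, mul_one_div_cancel ha, one_pow, one_mul]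

/-- The smaller indices of the quadratic monomials of weight `l` in the first `n` variables. -/
abbrev quadIndex (n l : ℕ) : Finset ℕ := Finset.Icc (l + 1 - n) (l / 2)

/-- The quadratic polynomial with prescribed coefficients with respect to the products of the
normalized variables `xᵢ / i!`. -/
noncomputable def quadForm (n l : ℕ) : (quadIndex n l → ℂ) →ₗ[ℂ] MvPolynomial ℕ ℂ :=
  Fintype.linearCombination ℂ fun i : quadIndex n l =>
    monomial (Finsupp.single i.1 1 + Finsupp.single (l - i.1) 1)
      (((i.1.factorial : ℂ) * ((l - i.1).factorial : ℂ))⁻¹)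

lemma quadForm_apply (n l : ℕ) (c : quadIndex n l → ℂ) :
    quadForm n l c = ∑ i, c i • monomial (Finsupp.single i.1 1 + Finsupp.single (l - i.1) 1)
      (((i.1.factorial : ℂ) * ((l - i.1).factorial : ℂ))⁻¹) :=
  Fintype.linearCombination_apply ..

lemma eval_iota_quadForm (n l : ℕ) (c : quadIndex n l → ℂ) (a : ℕ → ℂ) :
    eval (iota a) (quadForm n l c) = ∑ i, c i * (invTaylor i.1 a * invTaylor (l - i.1) a) := by
  rw [quadForm_apply, map_sum]
  refine Finset.sum_congr rfl fun i _ => ?_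
  rw [smul_eval, monomial_add_single, pow_one, map_mul, eval_X, eval_monomial]
  simp only [Finsupp.prod_single_index, pow_zero, pow_one, invTaylor]
  field_simp

lemma single_add_single_inj {l i j : ℕ} (hi : i ≤ l / 2) (hj : j ≤ l / 2)
    (h : (Finsupp.single i 1 + Finsupp.single (l - i) 1 : ℕ →₀ ℕ) =
      Finsupp.single j 1 + Finsupp.single (l - j) 1) : i = j := by
  have := DFunLike.congr_fun h i
  simp only [Finsupp.add_apply, Finsupp.single_apply] at this
  split_ifs at this <;> omega

lemma quadForm_injective (n l : ℕ) : Function.Injective (quadForm n l) := by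
  rw [injective_iff_map_eq_zero]
  intro c hc
  ext i
  have h := congrArg (coeff (Finsupp.single i.1 1 + Finsupp.single (l - i.1) 1)) hc
  rw [quadForm_apply, coeff_sum, Finset.sum_eq_single i] at h
  · have h1 := i.1.factorial_ne_zero
    have h2 := (l - i.1).factorial_ne_zero
    simpa [coeff_smul, coeff_monomial, h1, h2] using h
  · intro j _ hji
    rw [coeff_smul, coeff_monomial, if_neg, smul_zero]
    exact fun h => hji (Subtype.ext (single_add_single_inj (Finset.mem_Icc.1 j.2).2
      (Finset.mem_Icc.1 i.2).2 h))
  · simp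

lemma quadForm_mem (n l : ℕ) (c : quadIndex n l → ℂ) :
    quadForm n l c ∈ supported ℂ (Set.Iio n) ∧
      quadForm n l c ∈ homogeneousSubmodule ℕ ℂ 2 ∧
      quadForm n l c ∈ weightedHomogeneousSubmodule ℂ (fun i : ℕ => i) l := by
  rw [quadForm_apply]
  refine ⟨sum_mem fun i _ => Subalgebra.smul_mem _ ?_ _, sum_mem fun i _ =>
    Submodule.smul_mem _ _ ?_, sum_mem fun i _ => Submodule.smul_mem _ _ ?_⟩
  · have hi := Finset.mem_Icc.1 i.2
    rw [add_comm, monomial_single_add, pow_one]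
    refine mul_mem (X_mem_supported_Iio (by omega)) ?_
    rw [← C_mul_X_eq_monomial]
    exact mul_mem (Subalgebra.algebraMap_mem _ _) (X_mem_supported_Iio (by omega))
  · rw [mem_homogeneousSubmodule]
    exact isHomogeneous_monomial _ (by simp [map_add])
  · have hi := Finset.mem_Icc.1 i.2
    rw [mem_weightedHomogeneousSubmodule]
    refine isWeightedHomogeneous_monomial _ _ _ ?_
    simp only [map_add, Finsupp.weight_single, one_smul]
    omega

lemma exists_eq_single_add_single {m : ℕ →₀ ℕ} (h : m.degree = 2) :
    ∃ i j, i ≤ j ∧ m = Finsupp.single i 1 + Finsupp.single j 1 := by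
  have hcard : (Finsupp.toMultiset m).card = 2 := by
    rw [Finsupp.card_toMultiset]; exact h
  obtain ⟨i, j, hij⟩ := Multiset.card_eq_two.1 hcard
  have hm : m = Finsupp.single i 1 + Finsupp.single j 1 := by
    apply Multiset.toFinsupp.symm.injective
    change Finsupp.toMultiset m = Finsupp.toMultiset _
    rw [hij, map_add, Finsupp.toMultiset_single, Finsupp.toMultiset_single]
    simp
  rcases le_total i j with h | h
  · exact ⟨i, j, h, hm⟩
  · exact ⟨j, i, h, hm.trans (add_comm ..)⟩

lemma mem_range_quadForm {n l : ℕ} {ρ : MvPolynomial ℕ ℂ} (hs : ρ ∈ supported ℂ (Set.Iio n))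
    (hd : ρ ∈ homogeneousSubmodule ℕ ℂ 2)
    (hw : ρ ∈ weightedHomogeneousSubmodule ℂ (fun i : ℕ => i) l) :
    ρ ∈ LinearMap.range (quadForm n l) := by
  rw [ρ.as_sum]
  refine sum_mem fun m hm => ?_
  have hc := mem_support_iff.1 hm
  have hdeg : m.degree = 2 := by
    rw [Finsupp.degree_eq_weight_one]
    exact (mem_homogeneousSubmodule _ _ |>.1 hd) hc
  obtain ⟨i, j, hij, rfl⟩ := exists_eq_single_add_single hdeg
  have hweight := (mem_weightedHomogeneousSubmodule _ _ _ _ |>.1 hw) hc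
  simp only [map_add, Finsupp.weight_single, one_smul] at hweight
  obtain rfl : j = l - i := by omega
  have hjn : l - i < n := by
    refine mem_supported.1 hs ?_
    rw [Finset.mem_coe, mem_vars_iff_mem_support]
    exact ⟨_, hm, by simp⟩
  have hi : i ∈ quadIndex n l := Finset.mem_Icc.2 (by omega)
  generalize coeff _ ρ = r
  refine ⟨Pi.single ⟨i, hi⟩ (r * ((i.factorial : ℂ) * ((l - i).factorial : ℂ))), ?_⟩
  have h1 : (i.factorial : ℂ) ≠ 0 := by exact_mod_cast i.factorial_ne_zero
  have h2 : ((l - i).factorial : ℂ) ≠ 0 := by exact_mod_cast (l - i).factorial_ne_zero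
  rw [quadForm, Fintype.linearCombination_apply_single, smul_monomial, smul_eq_mul,
    mul_assoc, mul_inv_cancel₀ (mul_ne_zero h1 h2), mul_one]

lemma mem_Sndl_two_iff {n l : ℕ} {ρ : MvPolynomial ℕ ℂ} :
    ρ ∈ Sndl n 2 l ↔ ∃ c, (fun a => eval (iota a) (quadForm n l c)) ∈ poleLE n n ∧
      quadForm n l c = ρ := by
  constructor
  · rintro ⟨⟨hS, hd⟩, hw⟩
    obtain ⟨hs, hp⟩ := mem_Sn_iff.1 hS
    obtain ⟨c, rfl⟩ := mem_range_quadForm hs hd hw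
    exact ⟨c, hp, rfl⟩
  · rintro ⟨c, hp, rfl⟩
    obtain ⟨hs, hd, hw⟩ := quadForm_mem n l c
    exact ⟨⟨mem_Sn_iff.2 ⟨hs, hp⟩, hd⟩, hw⟩

lemma eval_iota_quadForm_mem_poleLE_of_le {n l : ℕ} (hl : l + 2 ≤ n) (c : quadIndex n l → ℂ) :
    (fun a => eval (iota a) (quadForm n l c)) ∈ poleLE n n := by
  have h : (fun a => eval (iota a) (quadForm n l c)) =
      ∑ i, c i • (invTaylor i.1 * invTaylor (l - i.1)) := by
    ext a
    simp [eval_iota_quadForm]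
  rw [h]
  refine sum_mem fun i _ => Submodule.smul_mem _ _ ?_
  have hi := Finset.mem_Icc.1 i.2
  exact poleLE_mono (by omega) (by omega) (mul_mem_poleLE
    (invTaylor_mem_poleLE (n := n) (j := i.1) (by omega))
    (invTaylor_mem_poleLE (n := n) (j := l - i.1) (by omega)))

lemma eval_iota_quadForm_mem_poleLE_iff {n l : ℕ} (hl : n < l + 2) (c : quadIndex n l → ℂ) :
    (fun a => eval (iota a) (quadForm n l c)) ∈ poleLE n n ↔ ∑ i, c i = 0 := by
  constructor
  · rintro ⟨P, -, hP⟩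
    have key : (∑ i, c i) * (-1) ^ l = 0 := by
      refine eq_zero_of_forall_mul_pow_eq hl
        (aeval (fun i : ℕ => if i = 0 then Polynomial.X else if i = 1 then 1 else 0) P)
        fun ε hε => ?_
      have h := hP (fun i => if i = 0 then ε else if i = 1 then 1 else 0) (by simpa using hε)
      have hev : Polynomial.eval ε (aeval (fun i : ℕ =>
          if i = 0 then (Polynomial.X : Polynomial ℂ) else if i = 1 then 1 else 0) P) =
          eval (fun i => if i = 0 then ε else if i = 1 then 1 else 0) P := by
        rw [← Polynomial.coe_evalRingHom, map_aeval, eval]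
        congr 2
        · ext r
          simp
        · ext i
          simp only [Polynomial.coe_evalRingHom, apply_ite (Polynomial.eval ε), Polynomial.eval_X,
            Polynomial.eval_one, Polynomial.eval_zero]
      rw [hev, ← h]
      simp only [eval_iota_quadForm, invTaylor_linear ε hε, if_true]
      congr 1
      rw [Finset.sum_mul, Finset.sum_div]
      refine Finset.sum_congr rfl fun i _ => ?_
      have hi := Finset.mem_Icc.1 i.2
      rw [mul_div_assoc, div_mul_div_comm, ← pow_add, ← pow_add,
        show i.1 + (l - i.1) = l by omega, show i.1 + 1 + (l - i.1 + 1) = l + 2 by omega]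
    simpa using key
  · intro hc
    have h : (fun a => eval (iota a) (quadForm n l c)) =
        ∑ i, c i • (invTaylor i.1 * invTaylor (l - i.1) -
          invTaylor (l + 1 - n) * invTaylor (l - (l + 1 - n))) := by
      ext a
      simp only [eval_iota_quadForm, Finset.sum_apply, Pi.smul_apply, Pi.sub_apply, Pi.mul_apply,
        smul_eq_mul, mul_sub, Finset.sum_sub_distrib, ← Finset.sum_mul, hc, zero_mul, sub_zero]
    rw [h]
    refine sum_mem fun i _ => Submodule.smul_mem _ _ ?_
    have hi := Finset.mem_Icc.1 i.2
    exact invTaylor_mul_sub_mem_poleLE (by omega) hi.1 hi.2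

lemma finrank_Sndl_two_of_le {n l : ℕ} (hl : l + 2 ≤ n) :
    Module.finrank ℂ (Sndl n 2 l) = 1 + l / 2 := by
  have h : Sndl n 2 l = LinearMap.range (quadForm n l) := by
    ext ρ
    simp [mem_Sndl_two_iff, eval_iota_quadForm_mem_poleLE_of_le hl]
  rw [h, LinearMap.finrank_range_of_inj (quadForm_injective n l), Module.finrank_fintype_fun_eq_card,
    Fintype.card_coe, Nat.card_Icc]
  omega

lemma finrank_Sndl_two_of_lt {n l : ℕ} (hl : n < l + 2) (hl' : l + 4 ≤ 2 * n) :
    Module.finrank ℂ (Sndl n 2 l) = 1 + (2 * n - 4 - l) / 2 := by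
  let f : Module.Dual ℂ (quadIndex n l → ℂ) := ∑ i, LinearMap.proj i
  have hf (c) : f c = ∑ i, c i := by simp [f]
  have h : Sndl n 2 l = (LinearMap.ker f).map (quadForm n l) := by
    ext ρ
    simp [mem_Sndl_two_iff, eval_iota_quadForm_mem_poleLE_iff hl, hf]
  have hf0 : f ≠ 0 := by
    intro h0
    have := hf (Pi.single ⟨l / 2, Finset.mem_Icc.2 (by omega)⟩ 1)
    simp [h0] at this
  have hk := Module.Dual.finrank_ker_add_one_of_ne_zero hf0
  rw [Module.finrank_fintype_fun_eq_card, Fintype.card_coe, Nat.card_Icc] at hk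
  rw [h, ← (Submodule.equivMapOfInjective _ (quadForm_injective n l) _).finrank_eq]
  omega

/-- Let `n ≥ 2`. Then `dim S_{n,2,l} = 1 + ⌊l/2⌋` for `0 ≤ l ≤ n−2`, and
`dim S_{n,2,l} = 1 + ⌊(2n−4−l)/2⌋` for `n−1 ≤ l ≤ 2n−4`. In particular
`1 ≤ dim S_{n,2,l} ≤ ⌊n/2⌋` for all `0 ≤ l ≤ 2n−4`. -/
theorem stmt1 (n : ℕ) (hn : 2 ≤ n) :
    (∀ l ≤ n - 2, Module.finrank ℂ ↥(Sndl n 2 l) = 1 + l / 2) ∧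
    (∀ l, n - 1 ≤ l → l ≤ 2 * n - 4 →
      Module.finrank ℂ ↥(Sndl n 2 l) = 1 + (2 * n - 4 - l) / 2) ∧
    (∀ l ≤ 2 * n - 4,
      1 ≤ Module.finrank ℂ ↥(Sndl n 2 l) ∧ Module.finrank ℂ ↥(Sndl n 2 l) ≤ n / 2) := by

  have h₁ : ∀ l ≤ n - 2, Module.finrank ℂ ↥(Sndl n 2 l) = 1 + l / 2 :=
    fun l hl => finrank_Sndl_two_of_le (by omega)
  have h₂ : ∀ l, n - 1 ≤ l → l ≤ 2 * n - 4 →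
      Module.finrank ℂ ↥(Sndl n 2 l) = 1 + (2 * n - 4 - l) / 2 :=
    fun l hl hl' => finrank_Sndl_two_of_lt (by omega) (by omega)
  refine ⟨h₁, h₂, fun l hl => ?_⟩
  rcases le_or_gt l (n - 2) with h | h
  · rw [h₁ l h]
    omega
  · rw [h₂ l (by omega) hl]
    omega
end

section
/- Let n ≥ 4 and 1 ≤ k_2 ≤ n−3 be integers, and let M be a finite multiset of positive integers with at least n−1 elements (counted with multiplicity) whose sum is n−1+k_2. Then the number of orderings (linear arrangements) of M whose sequence of partial sums contains the value n−1 equals the number of orderings of M whose sequence of partial sums contains the value n−2. -/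
namespace OrderingPartialSums

open Polynomial Finset

section UnitIntegral

variable {R : Type*} [CommRing R] [Algebra ℚ R]

/-- The formal integral `∫₀¹ p(t) dt` of a polynomial `p` over a `ℚ`-algebra. -/
noncomputable def unitIntegral : R[X] →ₗ[R] R :=
  lsum fun k => ((k + 1 : ℚ)⁻¹) • LinearMap.id

lemma unitIntegral_monomial (k : ℕ) (c : R) :
    unitIntegral (monomial k c) = ((k + 1 : ℚ)⁻¹) • c := by
  simp [unitIntegral, lsum]

lemma unitIntegral_derivative (p : R[X]) :
    unitIntegral (derivative p) = p.eval 1 - p.eval 0 := by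
  induction p using Polynomial.induction_on' with
  | add p q hp hq => simp only [map_add, hp, hq, eval_add]; ring
  | monomial k c =>
    rcases k with _ | k
    · simp
    · have h : (k + 1 : ℚ) ≠ 0 := by positivity
      have hc : c * ((k : R) + 1) = (k + 1 : ℚ) • c := by
        rw [Algebra.smul_def]; simp [mul_comm]
      rw [derivative_monomial, Nat.add_sub_cancel, unitIntegral_monomial]
      push_cast
      rw [hc, smul_smul, inv_mul_cancel₀ h]
      simp

lemma unitIntegral_C_mul (c : R) (p : R[X]) :
    unitIntegral (C c * p) = c * unitIntegral p := by
  rw [C_mul', map_smul, smul_eq_mul]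

lemma unitIntegral_X_pow_mul_one_sub_X_pow (a b : ℕ) :
    ((a + b + 1).factorial : R) * unitIntegral ((X : R[X]) ^ a * (1 - X) ^ b) =
      (a.factorial * b.factorial : ℕ) := by
  induction b generalizing a with
  | zero =>
    have h := unitIntegral_derivative ((X : R[X]) ^ (a + 1))
    rw [derivative_X_pow, unitIntegral_C_mul] at h
    simp only [Nat.add_sub_cancel, eval_pow, eval_X, one_pow, ne_eq, Nat.add_eq_zero_iff,
      one_ne_zero, and_false, not_false_eq_true, zero_pow, sub_zero] at h
    rw [add_zero, Nat.factorial_succ, pow_zero, mul_one, Nat.factorial_zero, mul_one]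
    push_cast at h ⊢
    linear_combination (a.factorial : R) * h
  | succ b ih =>
    have h := unitIntegral_derivative ((X : R[X]) ^ (a + 1) * (1 - X) ^ (b + 1))
    have hd : derivative ((X : R[X]) ^ (a + 1) * (1 - X) ^ (b + 1)) =
        C (a + 1 : R) * (X ^ a * (1 - X) ^ (b + 1)) -
          C (b + 1 : R) * (X ^ (a + 1) * (1 - X) ^ b) := by
      simp only [derivative_mul, derivative_pow, derivative_X, derivative_sub, derivative_one,
        Nat.add_sub_cancel, map_add, map_natCast, map_one]
      push_cast
      ring
    rw [hd, map_sub, unitIntegral_C_mul, unitIntegral_C_mul] at h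
    simp only [eval_mul, eval_pow, eval_sub, eval_X, eval_one, sub_self, ne_eq,
      Nat.add_eq_zero_iff, one_ne_zero, and_false, not_false_eq_true, zero_pow, mul_zero,
      zero_mul] at h
    have h' := ih (a + 1)
    have hinv : (algebraMap ℚ R ((a + 1 : ℚ)⁻¹)) * (a + 1 : R) = 1 := by
      have : (a + 1 : R) = algebraMap ℚ R (a + 1) := by simp
      rw [this, ← map_mul, inv_mul_cancel₀ (by positivity), map_one]
    have hu : IsUnit (a + 1 : R) := IsUnit.of_mul_eq_one_right _ hinv
    apply hu.mul_left_cancel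
    rw [show a + (b + 1) + 1 = a + 1 + b + 1 by ring]
    rw [Nat.factorial_succ a] at h'
    rw [Nat.factorial_succ b]
    push_cast at h' ⊢
    linear_combination ((a + 1 + b + 1).factorial : R) * h + (b + 1 : R) * h'

end UnitIntegral

/-- `(X - 1) ^ (k + 1) * ∫₀¹ t ^ k * (1 + t * (X - 1)) ^ a dt` has no monomial of degree
between `1` and `a`. -/
lemma exists_sub_one_pow_mul_unitIntegral (k a : ℕ) :
    ∃ (c : ℚ) (q : ℚ[X]),
      (X - 1) ^ (k + 1) * unitIntegral ((X : ℚ[X][X]) ^ k * (1 + C (X - 1) * X) ^ a) =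
        C c + X ^ (a + 1) * q := by
  have key (k a : ℕ) : derivative ((X : ℚ[X][X]) ^ k * (1 + C (X - 1) * X) ^ (a + 1)) =
      C (k : ℚ[X]) * (X ^ (k - 1) * (1 + C (X - 1) * X) ^ (a + 1)) +
        C ((a + 1 : ℚ[X]) * (X - 1)) * (X ^ k * (1 + C (X - 1) * X) ^ a) := by
    simp only [derivative_mul, derivative_pow, derivative_X, derivative_one,
      derivative_C, Nat.add_sub_cancel, map_add, map_natCast, map_one, map_mul]
    push_cast
    ring
  have hC (a : ℕ) : (a + 1 : ℚ[X]) * C ((a + 1 : ℚ)⁻¹) = 1 := by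
    have : (a + 1 : ℚ[X]) = C (a + 1 : ℚ) := by simp
    rw [this, ← C_mul, mul_inv_cancel₀ (by positivity), C_1]
  induction k generalizing a with
  | zero =>
    have h := unitIntegral_derivative ((X : ℚ[X][X]) ^ 0 * (1 + C (X - 1) * X) ^ (a + 1))
    rw [key, map_add, unitIntegral_C_mul, unitIntegral_C_mul] at h
    simp at h
    refine ⟨-(a + 1 : ℚ)⁻¹, C ((a + 1 : ℚ)⁻¹), ?_⟩
    simp only [pow_zero, one_mul, zero_add, pow_one, map_neg, map_sub, map_one]
    have h2 := hC a
    linear_combination (-(X - 1 : ℚ[X]) * unitIntegral (((1 : ℚ[X][X]) + (C X - 1) * X) ^ a)) * h2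
      + C ((a + 1 : ℚ)⁻¹) * h
  | succ k ih =>
    obtain ⟨c, q, hq⟩ := ih (a + 1)
    have h := unitIntegral_derivative ((X : ℚ[X][X]) ^ (k + 1) * (1 + C (X - 1) * X) ^ (a + 1))
    rw [key, map_add, unitIntegral_C_mul, unitIntegral_C_mul, Nat.add_sub_cancel] at h
    simp only [eval_mul, eval_pow, eval_X, one_pow, eval_add, eval_one, eval_C, mul_one,
      add_sub_cancel, one_mul, ne_eq, Nat.add_eq_zero_iff, one_ne_zero, and_false,
      not_false_eq_true, zero_pow, zero_mul, sub_zero] at h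
    refine ⟨-(a + 1 : ℚ)⁻¹ * (k + 1) * c,
      C ((a + 1 : ℚ)⁻¹) * ((X - 1) ^ (k + 1) - ((k : ℚ[X]) + 1) * X * q), ?_⟩
    have h2 := hC a
    push_cast at h
    simp only [map_mul, map_neg, map_add, map_natCast, map_one] at h hq ⊢
    set J := unitIntegral ((X : ℚ[X][X]) ^ (k + 1) * (1 + C (X - 1) * X) ^ a)
    set J' := unitIntegral ((X : ℚ[X][X]) ^ k * (1 + C (X - 1) * X) ^ (a + 1))
    linear_combination (-(X - 1 : ℚ[X]) ^ (k + 2) * J) * h2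
      + C ((a + 1 : ℚ)⁻¹) * (X - 1) ^ (k + 1) * h - C ((a + 1 : ℚ)⁻¹) * (k + 1) * hq

lemma exists_equiv_of_map_univ_eq {α β γ : Type*} [Fintype α] [Fintype β]
    (f : α → γ) (g : β → γ) (h : (univ : Finset α).val.map f = (univ : Finset β).val.map g) :
    ∃ e : α ≃ β, ∀ a, g (e a) = f a := by
  classical
  have hcard (c : γ) : Fintype.card {a // f a = c} = Fintype.card {b // g b = c} := by
    have := congrArg (Multiset.count c) h
    rw [Multiset.count_map, Multiset.count_map] at this
    simp only [eq_comm (a := c)] at this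
    rw [Fintype.card_subtype, Fintype.card_subtype]
    exact this
  exact ⟨Equiv.ofFiberEquiv fun c => Fintype.equivOfCardEq (hcard c),
    Equiv.ofFiberEquiv_map _⟩

section SubsetSums

variable {ι : Type*} [Fintype ι] [DecidableEq ι]

lemma sum_factorial_mul_X_pow_eq_unitIntegral (w : ι → ℕ) :
    (∑ A : Finset ι, (((#A).factorial * (Fintype.card ι - #A).factorial : ℕ) : ℚ[X]) *
        X ^ ∑ i ∈ A, w i) =
      ((Fintype.card ι + 1).factorial : ℚ[X]) *
        unitIntegral (∏ i, (X * C (X ^ w i) + (1 - X) : ℚ[X][X])) := by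
  rw [Fintype.prod_add, map_sum, mul_sum]
  refine sum_congr rfl fun A _ => ?_
  have hA : #A + (Fintype.card ι - #A) = Fintype.card ι := by
    have := card_le_univ A
    omega
  rw [prod_mul_distrib, prod_const, prod_const, card_compl, ← map_prod, prod_pow_eq_pow_sum,
    mul_comm (X ^ #A), mul_assoc, unitIntegral_C_mul,
    ← unitIntegral_X_pow_mul_one_sub_X_pow, hA]
  ring

lemma X_pow_sub_X_eq {m : ℕ} (hm : 0 < m) :
    ∃ g : ℚ[X], g.natDegree ≤ m - 1 ∧ X ∣ g ∧ (X : ℚ[X]) ^ m - X = (X - 1) * g := by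
  obtain ⟨m, rfl⟩ := Nat.exists_eq_succ_of_ne_zero hm.ne'
  refine ⟨∑ i ∈ range m, X ^ (i + 1), ?_, ?_, ?_⟩
  · refine natDegree_sum_le_of_forall_le _ _ fun i hi => ?_
    rw [natDegree_X_pow]
    have := mem_range.1 hi
    omega
  · exact dvd_sum fun i _ => dvd_pow_self _ (by omega)
  · have := geom_sum_mul (X : ℚ[X]) m
    simp_rw [pow_succ, ← sum_mul]
    linear_combination -X * this

lemma coeff_sub_one_mul_sum_factorial (w : ι → ℕ) (hw : ∀ i, 0 < w i) {N : ℕ}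
    (hN : ∑ i, (w i - 1) < N) (hN' : N ≤ Fintype.card ι) :
    ((X - 1) * ∑ A : Finset ι, (((#A).factorial * (Fintype.card ι - #A).factorial : ℕ) : ℚ[X]) *
        X ^ ∑ i ∈ A, w i).coeff N = 0 := by
  choose g hg hXg hgw using fun i => X_pow_sub_X_eq (hw i)
  have hfac (i : ι) : (X * C (X ^ w i) + (1 - X) : ℚ[X][X]) =
      X * C ((X - 1) * g i) + (1 + C (X - 1) * X) := by
    rw [← hgw]
    simp only [map_sub, map_one]
    ring
  rw [sum_factorial_mul_X_pow_eq_unitIntegral, prod_congr rfl fun i _ => hfac i,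
    Fintype.prod_add, map_sum, mul_sum, mul_sum, finsetSum_coeff]
  refine sum_eq_zero fun A _ => ?_
  obtain ⟨c, q, hq⟩ := exists_sub_one_pow_mul_unitIntegral #A (Fintype.card ι - #A)
  have hA : #A + (Fintype.card ι - #A) = Fintype.card ι := by
    have := card_le_univ A
    omega
  obtain ⟨Q, hQ⟩ : X ^ #A ∣ ∏ i ∈ A, g i := by
    rw [← prod_const]
    exact prod_dvd_prod_of_dvd _ _ fun i _ => hXg i
  have hdeg : (∏ i ∈ A, g i).natDegree < N :=
    calc (∏ i ∈ A, g i).natDegree ≤ ∑ i ∈ A, (w i - 1) :=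
          (natDegree_prod_le _ _).trans (sum_le_sum fun i _ => hg i)
      _ ≤ ∑ i, (w i - 1) := sum_le_univ_sum_of_nonneg fun i => Nat.zero_le _
      _ < N := hN
  have hterm : (X - 1) * (((Fintype.card ι + 1).factorial : ℚ[X]) *
      unitIntegral ((∏ i ∈ A, (X * C ((X - 1) * g i) : ℚ[X][X])) *
        ∏ i ∈ Aᶜ, (1 + C (X - 1) * X))) =
      C ((Fintype.card ι + 1).factorial : ℚ) * (C c * ∏ i ∈ A, g i) +
        X ^ (Fintype.card ι + 1) * (C ((Fintype.card ι + 1).factorial : ℚ) * (q * Q)) := by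
    rw [prod_mul_distrib, prod_const, prod_const, card_compl, ← map_prod, prod_mul_distrib,
      prod_const, mul_comm (X ^ #A), mul_assoc (C _), unitIntegral_C_mul]
    have h1 : (X : ℚ[X]) ^ (Fintype.card ι + 1) =
        X ^ (Fintype.card ι - #A + 1) * X ^ #A := by
      rw [← pow_add]; congr 1; omega
    rw [h1, map_natCast]
    linear_combination ((Fintype.card ι + 1).factorial : ℚ[X]) * (∏ i ∈ A, g i) * hq +
      ((Fintype.card ι + 1).factorial : ℚ[X]) * X ^ (Fintype.card ι - #A + 1) * q * hQ
  rw [hterm, coeff_add, coeff_C_mul, coeff_C_mul, coeff_eq_zero_of_natDegree_lt hdeg,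
    coeff_X_pow_mul', if_neg (by omega)]
  simp

lemma sum_factorial_eq_of_subset_sum_succ (w : ι → ℕ) (hw : ∀ i, 0 < w i) {s : ℕ}
    (hs : ∑ i, (w i - 1) ≤ s) (hs' : s + 1 ≤ Fintype.card ι) :
    ∑ A : Finset ι with ∑ i ∈ A, w i = s + 1, (#A).factorial * (Fintype.card ι - #A).factorial =
      ∑ A : Finset ι with ∑ i ∈ A, w i = s,
        (#A).factorial * (Fintype.card ι - #A).factorial := by
  have h := coeff_sub_one_mul_sum_factorial w hw (Nat.lt_succ_of_le hs) hs'
  have hcoeff (t : ℕ) : (∑ A : Finset ι,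
      (((#A).factorial * (Fintype.card ι - #A).factorial : ℕ) : ℚ[X]) *
        X ^ ∑ i ∈ A, w i).coeff t =
      ((∑ A : Finset ι with ∑ i ∈ A, w i = t,
        (#A).factorial * (Fintype.card ι - #A).factorial : ℕ) : ℚ) := by
    rw [finsetSum_coeff, sum_filter, Nat.cast_sum]
    refine sum_congr rfl fun A _ => ?_
    rw [← C_eq_natCast, coeff_C_mul_X_pow]
    simp only [eq_comm (a := t)]
    split_ifs <;> simp
  rw [sub_mul, one_mul, coeff_sub, Nat.succ_eq_add_one, coeff_X_mul, hcoeff, hcoeff,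
    sub_eq_zero] at h
  exact_mod_cast h.symm

/-- The list of the values of `w`, in the order given by the numbering `f`. -/
def orderedValues (w : ι → ℕ) (f : Numbering ι) : List ℕ :=
  List.ofFn fun j => w (f.symm j)

omit [DecidableEq ι] in
lemma coe_orderedValues (w : ι → ℕ) (f : Numbering ι) :
    (orderedValues w f : Multiset ℕ) = univ.val.map w := by
  rw [orderedValues, ← Fin.univ_val_map, ← Function.comp_def w, ← Multiset.map_map]
  congr 1
  exact congrArg Finset.val (univ_map_equiv_to_embedding f.symm)

omit [DecidableEq ι] in
lemma exists_orderedValues_eq (w : ι → ℕ) {l : List ℕ} (hl : (l : Multiset ℕ) = univ.val.map w) :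
    ∃ f : Numbering ι, orderedValues w f = l := by
  have hlen : l.length = Fintype.card ι := by
    simpa using congrArg Multiset.card hl
  obtain ⟨e, he⟩ := exists_equiv_of_map_univ_eq w l.get (by rw [← hl, Fin.univ_val_map,
    List.ofFn_get])
  refine ⟨e.trans (finCongr hlen), List.ext_getElem (by simp [orderedValues, hlen]) ?_⟩
  intro j hj hj'
  simp [orderedValues, ← he]

lemma card_orderedValues_fiber (w : ι → ℕ) (f : Numbering ι) :
    #{g : Numbering ι | orderedValues w g = orderedValues w f} =
      #{σ : Equiv.Perm ι | w ∘ σ = w} := by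
  refine card_bij' (fun g _ => f.trans g.symm) (fun σ _ => σ.symm.trans f) ?_ ?_ ?_ ?_
  · intro g hg
    simp only [mem_filter, mem_univ, true_and, orderedValues, List.ofFn_inj] at hg ⊢
    ext i
    simpa using congrFun hg (f i)
  · intro σ hσ
    simp only [mem_filter, mem_univ, true_and, orderedValues, List.ofFn_inj] at hσ ⊢
    ext j
    simpa using congrFun hσ (f.symm j)
  · intro g _
    ext i
    simp
  · intro σ _
    ext i
    simp

lemma ncard_orderings_mul (w : ι → ℕ) (P : List ℕ → Prop) [DecidablePred P] :
    {l : List ℕ | (l : Multiset ℕ) = univ.val.map w ∧ P l}.ncard *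
        #{σ : Equiv.Perm ι | w ∘ σ = w} =
      #{f : Numbering ι | P (orderedValues w f)} := by
  have hset : {l : List ℕ | (l : Multiset ℕ) = univ.val.map w ∧ P l} =
      (({f : Numbering ι | P (orderedValues w f)} : Finset _).image (orderedValues w) :
        Finset (List ℕ)) := by
    ext l
    simp only [Set.mem_ofPred_eq, coe_image, coe_filter, mem_univ, true_and, Set.mem_image]
    constructor
    · rintro ⟨hl, hP⟩
      obtain ⟨f, rfl⟩ := exists_orderedValues_eq w hl
      exact ⟨f, hP, rfl⟩
    · rintro ⟨f, hP, rfl⟩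
      exact ⟨coe_orderedValues w f, hP⟩
  rw [hset, Set.ncard_coe_finset, card_eq_sum_card_image (orderedValues w), sum_const_nat]
  intro l hl
  obtain ⟨f, hf, rfl⟩ := mem_image.1 hl
  rw [← card_orderedValues_fiber w f, filter_filter]
  congr 1
  refine filter_congr fun g _ => ⟨fun h => h.2, fun h => ⟨?_, h⟩⟩
  rw [h]
  exact (mem_filter.1 hf).2

/-- Some nonempty initial segment of `l` has sum `s`. -/
def HasPartialSum (s : ℕ) (l : List ℕ) : Prop :=
  ∃ i, 1 ≤ i ∧ i ≤ l.length ∧ (l.take i).sum = s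

omit [DecidableEq ι] in
lemma sum_take_orderedValues (w : ι → ℕ) (f : Numbering ι) (i : ℕ) :
    ((orderedValues w f).take i).sum = ∑ x with (f x : ℕ) < i, w x := by
  rw [orderedValues, List.sum_take_ofFn]
  exact sum_bij' (fun j _ => f.symm j) (fun x _ => f x) (by simp) (by simp) (by simp) (by simp)
    (by simp)

omit [DecidableEq ι] in
lemma hasPartialSum_orderedValues (w : ι → ℕ) {s : ℕ} (hs : 0 < s) (f : Numbering ι) :
    HasPartialSum s (orderedValues w f) ↔
      ∃ A : Finset ι, ∑ i ∈ A, w i = s ∧ f.IsPrefix A := by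
  have hcard (i : ℕ) (hi : i ≤ Fintype.card ι) : #{x | (f x : ℕ) < i} = i := by
    rw [card_equiv f (t := ({j : Fin (Fintype.card ι) | (j : ℕ) < i} : Finset _)) (by simp), Fin.card_filter_val_lt, min_eq_right hi]
  constructor
  · rintro ⟨i, -, hi, h⟩
    rw [orderedValues, List.length_ofFn] at hi
    refine ⟨({x | (f x : ℕ) < i} : Finset ι), by rw [← h, sum_take_orderedValues], fun x => ?_⟩
    rw [hcard i hi]
    simp
  · rintro ⟨A, hA, hf⟩
    have hfA : ({x | (f x : ℕ) < #A} : Finset ι) = A := by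
      ext x
      simp [hf x]
    refine ⟨#A, ?_, ?_, ?_⟩
    · rw [Nat.one_le_iff_ne_zero, Ne, card_eq_zero]
      rintro rfl
      simp [hs.ne] at hA
    · rw [orderedValues, List.length_ofFn]
      exact card_le_univ A
    · rw [sum_take_orderedValues, hfA, hA]

open Classical in
lemma card_hasPartialSum (w : ι → ℕ) (hw : ∀ i, 0 < w i) {s : ℕ} (hs : 0 < s) :
    #{f : Numbering ι | HasPartialSum s (orderedValues w f)} =
      ∑ A : Finset ι with ∑ i ∈ A, w i = s,
        (#A).factorial * (Fintype.card ι - #A).factorial := by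
  have hU : ({f : Numbering ι | HasPartialSum s (orderedValues w f)} : Finset _) =
      ({A : Finset ι | ∑ i ∈ A, w i = s} : Finset _).biUnion Numbering.prefixed := by
    ext f
    simp [hasPartialSum_orderedValues w hs]
  have eq_of_subset {A B : Finset ι} (hA : ∑ i ∈ A, w i = s) (hB : ∑ i ∈ B, w i = s)
      (h : A ⊆ B) : A = B := by
    by_contra hne
    obtain ⟨x, hx, hxA⟩ := exists_of_ssubset (h.ssubset_of_ne hne)
    have := sum_lt_sum_of_subset h hx hxA (hw x) fun _ _ _ => Nat.zero_le _
    omega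
  rw [hU, card_biUnion]
  · exact sum_congr rfl fun A _ => Numbering.card_prefixed A
  · intro A hA B hB hne
    replace hA : ∑ i ∈ A, w i = s := by simpa using hA
    replace hB : ∑ i ∈ B, w i = s := by simpa using hB
    exact Numbering.disjoint_prefixed_prefixed (fun h => hne (eq_of_subset hA hB h))
      fun h => hne (eq_of_subset hB hA h).symm

/-- Orderings of positive weights hit `s + 1` as often as `s`, provided that `s` is at least the
total excess of the weights over `1` and smaller than the number of weights. -/
lemma ncard_hasPartialSum_succ (w : ι → ℕ) (hw : ∀ i, 0 < w i) {s : ℕ} (hs : 0 < s)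
    (hE : ∑ i, (w i - 1) ≤ s) (hcard : s + 1 ≤ Fintype.card ι) :
    {l : List ℕ | (l : Multiset ℕ) = univ.val.map w ∧ HasPartialSum (s + 1) l}.ncard =
      {l : List ℕ | (l : Multiset ℕ) = univ.val.map w ∧ HasPartialSum s l}.ncard := by
  classical
  have hpos : 0 < #{σ : Equiv.Perm ι | w ∘ σ = w} :=
    card_pos.2 ⟨1, by simp⟩
  apply Nat.eq_of_mul_eq_mul_right hpos
  rw [ncard_orderings_mul, ncard_orderings_mul, card_hasPartialSum w hw s.succ_pos,
    card_hasPartialSum w hw hs, sum_factorial_eq_of_subset_sum_succ w hw hE hcard]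

end SubsetSums

end OrderingPartialSums

/-- Let `n ≥ 4`, `1 ≤ k₂ ≤ n−3`, and let `M` be a finite multiset of positive integers
with at least `n−1` elements (with multiplicity) and sum `n−1+k₂`. Then the number of
orderings (lists realizing `M`) whose sequence of partial sums contains the value `n−1`
equals the number of orderings whose sequence of partial sums contains the value `n−2`. -/
theorem stmt5 (n k₂ : ℕ) (hn : 4 ≤ n) (hk : 1 ≤ k₂) (hk' : k₂ ≤ n - 3)
    (M : Multiset ℕ) (hpos : ∀ x ∈ M, 0 < x) (hcard : n - 1 ≤ Multiset.card M)
    (hsum : M.sum = n - 1 + k₂) :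
    {l : List ℕ | (l : Multiset ℕ) = M ∧
        ∃ i, 1 ≤ i ∧ i ≤ l.length ∧ (l.take i).sum = n - 1}.ncard =
    {l : List ℕ | (l : Multiset ℕ) = M ∧
        ∃ i, 1 ≤ i ∧ i ≤ l.length ∧ (l.take i).sum = n - 2}.ncard := by
  obtain ⟨L, rfl⟩ := Quot.exists_rep M
  have hM : (Finset.univ : Finset (Fin L.length)).val.map L.get = (L : Multiset ℕ) := by
    rw [Fin.univ_val_map, List.ofFn_get]
  have hw (i : Fin L.length) : 0 < L.get i := hpos _ (by simp)
  have hsum' : ∑ i, L.get i = n - 1 + k₂ := by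
    rw [← hsum, Finset.sum, hM]
    rfl
  have hexcess : ∑ i, (L.get i - 1) + L.length = ∑ i, L.get i := by
    rw [← Finset.sum_congr rfl fun i _ => Nat.sub_add_cancel (hw i), Finset.sum_add_distrib]
    simp
  have hlen : n - 1 ≤ L.length := hcard
  have h := OrderingPartialSums.ncard_hasPartialSum_succ L.get hw (s := n - 2) (by omega)
    (by omega) (by rw [Fintype.card_fin]; omega)
  rw [hM, show n - 2 + 1 = n - 1 by omega] at h
  exact h
end

section
/- Let n ≥ 1 and d ≥ 0 be integers, and let ρ ∈ S_{n,d}. Write ρ = ∑_l ρ_l, where ρ_l is the sum of those monomials of ρ whose weighted degree equals l. Then each weighted-homogeneous component ρ_l belongs to S_{n,d}. Consequently, S_{n,d} is the direct sum of the subspaces S_{n,d,l}. -/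
open MvPolynomial

theorem iota_mul_pow (a : ℕ → ℂ) (t : ℂ) (k : ℕ) :
    iota (fun j => a j * t ^ j) k = iota a k * t ^ k := by
  induction k using Nat.strong_induction_on with
  | _ k ih =>
    cases k with
    | zero => simp [iota]
    | succ k =>
      rw [iota, iota, mul_assoc, Finset.sum_mul]
      simp only [pow_zero, mul_one]
      congr 1
      refine Finset.sum_congr rfl fun j hj => ?_
      have hjk : j ≤ k := Nat.lt_succ_iff.mp (Finset.mem_range.mp hj)
      rw [ih (k - j) (by omega), show k + 1 = (j + 1) + (k - j) by omega, pow_add]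
      ring

/-- The polynomial in `t` whose value is `p` evaluated at `(a₀, t a₁, t² a₂, …)` has the values of
the weighted-homogeneous components of `p` at `a` as its coefficients. -/
theorem coeff_aeval_C_mul_X_pow (a : ℕ → ℂ) (p : MvPolynomial ℕ ℂ) (l : ℕ) :
    (aeval (fun j : ℕ => Polynomial.C (a j) * Polynomial.X ^ j) p).coeff l =
      eval a (weightedHomogeneousComponent (fun i : ℕ => i) l p) := by
  induction p using MvPolynomial.induction_on' with
  | monomial s c =>
    have hs : (s.prod fun i k => (Polynomial.C (a i) * Polynomial.X ^ i) ^ k) =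
        Polynomial.C (s.prod fun i k => a i ^ k) *
          Polynomial.X ^ Finsupp.weight (fun i : ℕ => i) s := by
      simp only [Finsupp.prod, mul_pow, Finset.prod_mul_distrib, map_prod, map_pow,
        Finsupp.weight_apply, Finsupp.sum, ← pow_mul, Finset.prod_pow_eq_pow_sum, smul_eq_mul,
        mul_comm]
    rw [aeval_monomial, hs, weightedHomogeneousComponent_of_mem
      (isWeightedHomogeneous_monomial (fun i : ℕ => i) s c rfl), Polynomial.algebraMap_apply,
      Algebra.algebraMap_self_apply, Polynomial.coeff_C_mul, Polynomial.coeff_C_mul_X_pow]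
    split_ifs <;> simp [eval_monomial]
  | add p q hp hq => simp [hp, hq]

theorem eval_aeval_C_mul_X_pow (a : ℕ → ℂ) (p : MvPolynomial ℕ ℂ) (t : ℂ) :
    (aeval (fun j : ℕ => Polynomial.C (a j) * Polynomial.X ^ j) p).eval t =
      eval (fun j => a j * t ^ j) p := by
  induction p using MvPolynomial.induction_on with
  | C c => simp
  | add p q hp hq => simp [hp, hq]
  | mul_X p i hp => simp [hp]

theorem JetRel.weightedHomogeneousComponent {n : ℕ} {p q : MvPolynomial ℕ ℂ}
    (h : JetRel n p q) (l : ℕ) :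
    JetRel n (weightedHomogeneousComponent (fun i : ℕ => i) l p)
      (weightedHomogeneousComponent (fun i : ℕ => i) l q) := by
  intro a ha
  have key : aeval (fun j : ℕ => Polynomial.C (a j) * Polynomial.X ^ j) p =
      Polynomial.C (a 0 ^ n) *
        aeval (fun j : ℕ => Polynomial.C (iota a j) * Polynomial.X ^ j) q := by
    refine Polynomial.funext fun t => ?_
    rw [Polynomial.eval_mul, Polynomial.eval_C, eval_aeval_C_mul_X_pow, eval_aeval_C_mul_X_pow,
      h _ (by simpa using ha), funext (iota_mul_pow a t)]
    simp
  rw [← coeff_aeval_C_mul_X_pow, key, Polynomial.coeff_C_mul, coeff_aeval_C_mul_X_pow]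

theorem weightedHomogeneousComponent_mem_supported {s : Set ℕ} {p : MvPolynomial ℕ ℂ}
    (hp : p ∈ supported ℂ s) (l : ℕ) :
    weightedHomogeneousComponent (fun i : ℕ => i) l p ∈ supported ℂ s := by
  rw [mem_supported] at hp ⊢
  refine Set.Subset.trans (fun i hi => ?_) hp
  simp only [Finset.mem_coe, mem_vars_iff_mem_support, mem_support_iff, 
    coeff_weightedHomogeneousComponent] at hi ⊢
  obtain ⟨e, he, hie⟩ := hi
  exact ⟨e, fun h => he (by simp [h]), hie⟩

theorem weightedHomogeneousComponent_mem_Snd {n d : ℕ} {p : MvPolynomial ℕ ℂ}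
    (hp : p ∈ Snd n d) (l : ℕ) :
    weightedHomogeneousComponent (fun i : ℕ => i) l p ∈ Snd n d := by
  obtain ⟨⟨hs, q, hq, hpq⟩, hd⟩ := hp
  refine ⟨⟨weightedHomogeneousComponent_mem_supported hs l, _,
    weightedHomogeneousComponent_mem_supported hq l, hpq.weightedHomogeneousComponent l⟩, ?_⟩
  intro e he
  rw [coeff_weightedHomogeneousComponent] at he
  exact hd fun h => he (by simp [h])

/-- **Proposition 3.3.** Let `n ≥ 1`, `d ≥ 0` and `ρ ∈ S_{n,d}`. Every weighted-homogeneous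
component of `ρ` (the sum of its monomials of weighted degree `l`) again belongs to
`S_{n,d}`. Consequently `S_{n,d}` is the direct sum of the subspaces `S_{n,d,l}`. -/
theorem stmt9 (n d : ℕ) (hn : 1 ≤ n) (ρ : MvPolynomial ℕ ℂ) (hρ : ρ ∈ Snd n d) :
    (∀ l : ℕ, weightedHomogeneousComponent (fun i : ℕ => i) l ρ ∈ Snd n d) ∧
    (Snd n d = ⨆ l : ℕ, Sndl n d l) ∧
    (∀ l : ℕ, Disjoint (Sndl n d l) (⨆ l' ∈ {l' : ℕ | l' ≠ l}, Sndl n d l')) := by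
  refine ⟨weightedHomogeneousComponent_mem_Snd hρ, le_antisymm (fun p hp => ?_)
    (iSup_le fun l => inf_le_left), fun l => ?_⟩
  · rw [← sum_weightedHomogeneousComponent (fun i : ℕ => i) p,
      finsum_eq_sum _ (weightedHomogeneousComponent_finsupp p)]
    exact Submodule.sum_mem _ fun l _ => Submodule.mem_iSup_of_mem l
      ⟨weightedHomogeneousComponent_mem_Snd hp l, weightedHomogeneousComponent_mem _ p l⟩
  · let := weightedDecomposition ℂ (fun i : ℕ => i)
    exact ((DirectSum.Decomposition.isInternal
      (weightedHomogeneousSubmodule ℂ fun i : ℕ => i)).submodule_iSupIndep l).mono inf_le_right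
      (iSup₂_mono fun _ _ => inf_le_right)
end

section
/- Let n ≥ 1 and suppose ρ_1 ∼_n ρ_2 for polynomials ρ_1, ρ_2 ∈ ℂ[x_0, …, x_{n−1}]. For each 0 ≤ d ≤ n, let ρ_1^d and ρ_2^{n−d} denote the homogeneous components of ρ_1 of total degree d and of ρ_2 of total degree n−d, respectively. Then ρ_1^d ∼_n ρ_2^{n−d}. Consequently, every homogeneous component of an element of S_n again belongs to S_n, and S_n = ⊕_{d=0}^{n} S_{n,d}. -/
open MvPolynomial

lemma iota_smul (c : ℂ) (hc : c ≠ 0) (a : ℕ → ℂ) (ha : a 0 ≠ 0) (k : ℕ) :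
    iota (c • a) k = c⁻¹ * iota a k := by
  induction k using Nat.strong_induction_on with
  | _ k ih =>
    cases k with
    | zero => simp [iota, mul_comm]
    | succ k =>
      rw [iota, iota]
      have hsum : ∑ j ∈ Finset.range (k + 1),
          ((k + 1).choose (j + 1) : ℂ) * (c • a) (j + 1) * iota (c • a) (k - j) =
          ∑ j ∈ Finset.range (k + 1),
          ((k + 1).choose (j + 1) : ℂ) * a (j + 1) * iota a (k - j) := by
        refine Finset.sum_congr rfl fun j _ => ?_
        rw [ih (k - j) (by omega)]
        simp only [Pi.smul_apply, smul_eq_mul]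
        field_simp
      rw [hsum]
      simp only [Pi.smul_apply, smul_eq_mul]
      field_simp

lemma MvPolynomial.IsHomogeneous.eval_smul_point {σ R : Type*} [CommSemiring R]
    {φ : MvPolynomial σ R} {d : ℕ} (hφ : φ.IsHomogeneous d) (c : R) (a : σ → R) :
    eval (c • a) φ = c ^ d * eval a φ := by
  rw [eval_eq, eval_eq, Finset.mul_sum]
  refine Finset.sum_congr rfl fun m hm => ?_
  have hdeg : ∑ i ∈ m.support, m i = d := by
    have h := hφ (mem_support_iff.mp hm)
    rwa [Pi.one_def, ← Finsupp.degree_eq_weight_one] at h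
  simp only [Pi.smul_apply, smul_eq_mul, mul_pow, Finset.prod_mul_distrib,
    Finset.prod_pow_eq_pow_sum, hdeg]
  ring

lemma MvPolynomial.eval_smul_eq_sum {σ R : Type*} [CommSemiring R]
    (φ : MvPolynomial σ R) (c : R) (a : σ → R) :
    eval (c • a) φ =
      ∑ d ∈ Finset.range (φ.totalDegree + 1), c ^ d * eval a (homogeneousComponent d φ) := by
  conv_lhs => rw [← sum_homogeneousComponent φ]
  rw [map_sum]
  exact Finset.sum_congr rfl fun d _ =>
    (homogeneousComponent_isHomogeneous d φ).eval_smul_point c a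

lemma MvPolynomial.homogeneousComponent_mem_supported {σ R : Type*} [CommSemiring R] {s : Set σ}
    {φ : MvPolynomial σ R} (h : φ ∈ supported R s) (d : ℕ) :
    homogeneousComponent d φ ∈ supported R s := by
  rw [mem_supported] at h ⊢
  intro i hi
  obtain ⟨m, hm, him⟩ := (mem_vars_iff_mem_support i).mp hi
  refine h ((mem_vars_iff_mem_support i).mpr ⟨m, ?_, him⟩)
  rw [support_homogeneousComponent] at hm
  exact (Finset.mem_filter.mp hm).1

/-- If `∑ A_d c^d = c^n ∑ B_e c^{-e}` for all `c ≠ 0`, then `A_d = B_{n-d}` for `d ≤ n` and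
`A_d = 0` for `d > n`. -/
lemma coeff_eq_of_sum_pow_eq_sum_inv_pow {K : Type*} [Field K] [Infinite K] {n N M : ℕ}
    {A B : ℕ → K} (hA : ∀ d, N < d → A d = 0) (hB : ∀ e, M < e → B e = 0)
    (h : ∀ c : K, c ≠ 0 → ∑ d ∈ Finset.range (N + 1), c ^ d * A d =
      c ^ n * ∑ e ∈ Finset.range (M + 1), c⁻¹ ^ e * B e) (d : ℕ) :
    A d = if d ≤ n then B (n - d) else 0 := by
  let P : Polynomial K :=
    ∑ d ∈ Finset.range (N + 1), Polynomial.C (A d) * Polynomial.X ^ (d + M)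
  let Q : Polynomial K :=
    ∑ e ∈ Finset.range (M + 1), Polynomial.C (B e) * Polynomial.X ^ (n + (M - e))
  have hPQ : P = Q := by
    refine Polynomial.eq_of_infinite_eval_eq P Q
      ((Set.finite_singleton (0 : K)).infinite_compl.mono fun c hc => ?_)
    have hc : c ≠ 0 := hc
    have hP : P.eval c = c ^ M * ∑ d ∈ Finset.range (N + 1), c ^ d * A d := by
      simp only [P, Polynomial.eval_finsetSum, Finset.mul_sum, Polynomial.eval_mul,
        Polynomial.eval_C, Polynomial.eval_pow, Polynomial.eval_X]
      exact Finset.sum_congr rfl fun d _ => by ring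
    have hQ : Q.eval c = c ^ M * (c ^ n * ∑ e ∈ Finset.range (M + 1), c⁻¹ ^ e * B e) := by
      simp only [Q, Polynomial.eval_finsetSum, Finset.mul_sum, Polynomial.eval_mul,
        Polynomial.eval_C, Polynomial.eval_pow, Polynomial.eval_X]
      refine Finset.sum_congr rfl fun e he => ?_
      have he : e ≤ M := Nat.lt_succ_iff.mp (Finset.mem_range.mp he)
      rw [pow_add, pow_sub₀ c hc he, inv_pow]
      ring
    change P.eval c = Q.eval c
    rw [hP, hQ, h c hc]
  have hcoeff := congrArg (fun p => Polynomial.coeff p (d + M)) hPQ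
  simp only [P, Q, Polynomial.finsetSum_coeff, Polynomial.coeff_C_mul_X_pow,
    add_left_inj] at hcoeff
  rw [Finset.sum_ite_eq] at hcoeff
  have hleft : A d = if d ∈ Finset.range (N + 1) then A d else 0 := by
    split_ifs with hd
    · rfl
    · exact hA d (by simpa using hd)
  rw [hleft, hcoeff]
  split_ifs with hd
  · rw [Finset.sum_eq_single (n - d)]
    · split_ifs with hdM
      · rfl
      · exact (hB _ (by omega)).symm
    · intro e he hne
      have := Finset.mem_range.mp he
      exact if_neg (by omega)
    · intro hmem
      rw [Finset.mem_range] at hmem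
      rw [hB (n - d) (by omega), ite_self]
  · refine Finset.sum_eq_zero fun e he => if_neg ?_
    have := Finset.mem_range.mp he
    omega

lemma JetRel.eval_homogeneousComponent {n : ℕ} {ρ₁ ρ₂ : MvPolynomial ℕ ℂ}
    (h : JetRel n ρ₁ ρ₂) (a : ℕ → ℂ) (ha : a 0 ≠ 0) (d : ℕ) :
    eval a (homogeneousComponent d ρ₁) =
      if d ≤ n then a 0 ^ n * eval (iota a) (homogeneousComponent (n - d) ρ₂) else 0 := by
  refine coeff_eq_of_sum_pow_eq_sum_inv_pow (N := ρ₁.totalDegree) (M := ρ₂.totalDegree)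
    (A := fun d => eval a (homogeneousComponent d ρ₁))
    (B := fun e => a 0 ^ n * eval (iota a) (homogeneousComponent e ρ₂))
    (fun d hd => by simp only [homogeneousComponent_eq_zero d ρ₁ hd, map_zero])
    (fun e he => by simp only [homogeneousComponent_eq_zero e ρ₂ he, map_zero, mul_zero])
    (fun c hc => ?_) d
  have hrel := h (c • a) (by simp [hc, ha])
  have hiota : iota (c • a) = c⁻¹ • iota a := funext fun k => iota_smul c hc a ha k
  rw [hiota, eval_smul_eq_sum, eval_smul_eq_sum] at hrel
  rw [hrel, Pi.smul_apply, smul_eq_mul, mul_pow, mul_assoc, Finset.mul_sum]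
  congr 1
  exact Finset.sum_congr rfl fun e _ => by ring

lemma JetRel.homogeneousComponent {n : ℕ} {ρ₁ ρ₂ : MvPolynomial ℕ ℂ}
    (h : JetRel n ρ₁ ρ₂) {d : ℕ} (hd : d ≤ n) :
    JetRel n (homogeneousComponent d ρ₁) (homogeneousComponent (n - d) ρ₂) := fun a ha => by
  rw [h.eval_homogeneousComponent a ha d, if_pos hd]

lemma JetRel.homogeneousComponent_eq_zero {n : ℕ} {ρ₁ ρ₂ : MvPolynomial ℕ ℂ}
    (h : JetRel n ρ₁ ρ₂) {d : ℕ} (hd : n < d) : MvPolynomial.homogeneousComponent d ρ₁ = 0 := by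
  have hmul : X 0 * MvPolynomial.homogeneousComponent d ρ₁ = 0 := by
    refine MvPolynomial.funext fun a => ?_
    rw [map_mul, eval_X, map_zero]
    by_cases ha : a 0 = 0
    · rw [ha, zero_mul]
    · rw [h.eval_homogeneousComponent a ha d, if_neg hd.not_ge, mul_zero]
  exact (mul_eq_zero.mp hmul).resolve_left (X_ne_zero 0)

lemma homogeneousComponent_eq_zero_of_mem_Sn {n : ℕ} {ρ : MvPolynomial ℕ ℂ} (hρ : ρ ∈ Sn n)
    {d : ℕ} (hd : n < d) : homogeneousComponent d ρ = 0 := by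
  obtain ⟨-, ρ₂, -, hrel⟩ := hρ
  exact hrel.homogeneousComponent_eq_zero hd

lemma homogeneousComponent_mem_Sn {n : ℕ} {ρ : MvPolynomial ℕ ℂ} (hρ : ρ ∈ Sn n) (d : ℕ) :
    homogeneousComponent d ρ ∈ Sn n := by
  rcases le_or_gt d n with hd | hd
  · obtain ⟨hsupp, ρ₂, hsupp₂, hrel⟩ := hρ
    exact ⟨homogeneousComponent_mem_supported hsupp d, homogeneousComponent (n - d) ρ₂,
      homogeneousComponent_mem_supported hsupp₂ _, hrel.homogeneousComponent hd⟩
  · rw [homogeneousComponent_eq_zero_of_mem_Sn hρ hd]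
    exact zero_mem _

lemma Sn_eq_iSup_Snd (n : ℕ) : Sn n = ⨆ d ∈ Set.Iic n, Snd n d := by
  refine le_antisymm (fun ρ hρ => ?_) (iSup₂_le fun d _ => inf_le_left)
  rw [← sum_homogeneousComponent ρ]
  refine Submodule.sum_mem _ fun d _ => ?_
  rcases le_or_gt d n with hd | hd
  · exact le_iSup₂ (f := fun d (_ : d ∈ Set.Iic n) => Snd n d) d hd
      ⟨homogeneousComponent_mem_Sn hρ d, homogeneousComponent_mem d ρ⟩
  · rw [homogeneousComponent_eq_zero_of_mem_Sn hρ hd]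
    exact zero_mem _

lemma disjoint_Snd_iSup (n d : ℕ) (s : Set ℕ) :
    Disjoint (Snd n d) (⨆ d' ∈ s \ {d}, Snd n d') := by
  have hker : (⨆ d' ∈ s \ {d}, Snd n d') ≤ LinearMap.ker (homogeneousComponent d) := by
    refine iSup₂_le fun d' hd' p hp => ?_
    rw [LinearMap.mem_ker, homogeneousComponent_of_mem hp.2, if_neg fun h => hd'.2 h.symm]
  rw [Submodule.disjoint_def]
  intro p hp hp'
  have h := LinearMap.mem_ker.mp (hker hp')
  rwa [homogeneousComponent_of_mem hp.2, if_pos rfl] at h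

/-- Let `n ≥ 1` and suppose `ρ₁ ∼ₙ ρ₂` for `ρ₁, ρ₂ ∈ ℂ[x₀, …, x_{n−1}]`. For `0 ≤ d ≤ n`,
the homogeneous components satisfy `ρ₁^d ∼ₙ ρ₂^{n−d}`. Consequently every homogeneous
component of an element of `Sₙ` is in `Sₙ`, and `Sₙ = ⊕_{d=0}^{n} S_{n,d}`. -/
theorem stmt10 (n : ℕ) (hn : 1 ≤ n) (ρ₁ ρ₂ : MvPolynomial ℕ ℂ)
    (h₁ : ρ₁ ∈ supported ℂ (Set.Iio n)) (h₂ : ρ₂ ∈ supported ℂ (Set.Iio n))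
    (hrel : JetRel n ρ₁ ρ₂) :
    (∀ d ≤ n, JetRel n (homogeneousComponent d ρ₁) (homogeneousComponent (n - d) ρ₂)) ∧
    (∀ ρ ∈ Sn n, ∀ d : ℕ, homogeneousComponent d ρ ∈ Sn n) ∧
    (Sn n = ⨆ d ∈ Set.Iic n, Snd n d) ∧
    (∀ d ∈ Set.Iic n, Disjoint (Snd n d) (⨆ d' ∈ Set.Iic n \ {d}, Snd n d')) := by
  exact ⟨fun d hd => hrel.homogeneousComponent hd, fun ρ hρ d => homogeneousComponent_mem_Sn hρ d,
    Sn_eq_iSup_Snd n, fun d _ => disjoint_Snd_iSup n d _⟩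
end

section
/- Let n ≥ 1 be an integer and ρ ∈ S_n. Then the total degree of ρ is at most n, and the degree of ρ as a polynomial in the single variable x_{n−1} is at most 1. -/
open MvPolynomial

open Filter Topology

/-- A polynomial over `ℂ` growing at infinity at most like `xⁿ` has degree at most `n`. -/
theorem Polynomial.natDegree_le_of_tendsto_pow_mul_eval_inv {q : Polynomial ℂ} {n : ℕ} {l : ℂ}
    (h : Tendsto (fun s : ℂ => s ^ n * q.eval s⁻¹) (𝓝[≠] 0) (𝓝 l)) : q.natDegree ≤ n := by
  by_contra! hn
  have h₁ : Tendsto (fun s : ℂ => s ^ (q.natDegree - n) * (s ^ n * q.eval s⁻¹))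
      (𝓝[≠] 0) (𝓝 (0 ^ (q.natDegree - n) * l)) :=
    (((continuous_pow (q.natDegree - n)).tendsto (0 : ℂ)).mono_left nhdsWithin_le_nhds).mul h
  have h₂ : Tendsto (fun s : ℂ => q.reverse.eval s) (𝓝[≠] 0) (𝓝 (q.reverse.eval 0)) :=
    (q.reverse.continuous.tendsto 0).mono_left nhdsWithin_le_nhds
  have h₃ : (fun s : ℂ => s ^ (q.natDegree - n) * (s ^ n * q.eval s⁻¹)) =ᶠ[𝓝[≠] 0]
      fun s : ℂ => q.reverse.eval s := by
    filter_upwards [self_mem_nhdsWithin] with s hs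
    have hs : s ≠ 0 := hs
    let _ : Invertible s⁻¹ := invertibleOfNonzero (inv_ne_zero hs)
    have := Polynomial.eval₂_reverse_mul_pow (RingHom.id ℂ) s⁻¹ q
    simp only [invOf_eq_inv, inv_inv] at this
    rw [← mul_assoc, ← pow_add, Nat.sub_add_cancel hn.le, Polynomial.eval, ← this, Polynomial.eval,
      mul_comm, mul_assoc, ← mul_pow, inv_mul_cancel₀ hs, one_pow, mul_one]
  have h₄ := tendsto_nhds_unique (h₁.congr' h₃) h₂
  rw [zero_pow (by omega), zero_mul, ← Polynomial.coeff_zero_eq_eval_zero,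
    Polynomial.coeff_zero_reverse, eq_comm, Polynomial.leadingCoeff_eq_zero] at h₄
  simp [h₄] at hn

namespace MvPolynomial

variable {σ : Type*}

theorem IsHomogeneous.eval_const_mul {R : Type*} [CommSemiring R] {p : MvPolynomial σ R} {d : ℕ}
    (hp : p.IsHomogeneous d) (c : R) (v : σ → R) :
    eval (fun i => c * v i) p = c ^ d * eval v p := by
  rw [eval_eq, eval_eq, Finset.mul_sum]
  refine Finset.sum_congr rfl fun m hm => ?_
  have hd : ∑ i ∈ m.support, m i = d := by
    rw [← hp.degree_eq_sum_deg_support hm]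
  simp only [mul_pow, Finset.prod_mul_distrib, Finset.prod_pow_eq_pow_sum, hd]
  ring

/-- A polynomial growing at most like `xⁿ` along generic lines through the origin has total
degree at most `n`. -/
theorem totalDegree_le_of_tendsto {p : MvPolynomial σ ℂ} {n : ℕ} (i₀ : σ)
    (h : ∀ v : σ → ℂ, v i₀ ≠ 0 →
      ∃ l, Tendsto (fun s : ℂ => s ^ n * eval (fun i => s⁻¹ * v i) p) (𝓝[≠] 0) (𝓝 l)) :
    p.totalDegree ≤ n := by
  have hc : ∀ d, n < d → homogeneousComponent d p = 0 := by
    intro d hd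
    have hX : X i₀ * homogeneousComponent d p = 0 := by
      refine MvPolynomial.funext fun v => ?_
      rcases eq_or_ne (v i₀) 0 with hv | hv
      · simp [hv]
      obtain ⟨l, hl⟩ := h v hv
      let q : Polynomial ℂ := ∑ e ∈ Finset.range (p.totalDegree + 1),
        Polynomial.monomial e (eval v (homogeneousComponent e p))
      have hq : ∀ c : ℂ, q.eval c = eval (fun i => c * v i) p := by
        intro c
        conv_rhs => rw [← sum_homogeneousComponent p]
        simp only [q, Polynomial.eval_finsetSum, Polynomial.eval_monomial, map_sum,
          (homogeneousComponent_isHomogeneous _ p).eval_const_mul, mul_comm]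
      have hdeg : q.natDegree ≤ n :=
        Polynomial.natDegree_le_of_tendsto_pow_mul_eval_inv (l := l) (by simpa only [hq] using hl)
      have hqd := Polynomial.coeff_eq_zero_of_natDegree_lt (hdeg.trans_lt hd)
      simp only [q, Polynomial.finsetSum_coeff, Polynomial.coeff_monomial, Finset.sum_ite_eq',
        Finset.mem_range] at hqd
      split_ifs at hqd with hlt
      · simp [hqd]
      · simp [homogeneousComponent_eq_zero d p (by omega)]
    exact (mul_eq_zero.mp hX).resolve_left (X_ne_zero i₀)
  rw [← sum_homogeneousComponent p]
  refine totalDegree_finsetSum_le fun d _ => ?_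
  rcases le_or_gt d n with hd | hd
  · exact (homogeneousComponent_isHomogeneous d p).totalDegree_le.trans hd
  · simp [hc d hd]

/-- A polynomial function affine in the variable `x_i` has degree at most one in it. -/
theorem degreeOf_le_one_of_eval_update [DecidableEq σ] {R : Type*} [CommRing R] [IsDomain R]
    [Infinite R] {p : MvPolynomial σ R} (i : σ)
    (h : ∀ (v : σ → R) (z : R), eval (Function.update v i z) p =
      eval (Function.update v i 0) p +
        z * (eval (Function.update v i 1) p - eval (Function.update v i 0) p)) :
    p.degreeOf i ≤ 1 := by
  let P : R → MvPolynomial σ R := fun c => bind₁ (Function.update X i (C c)) p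
  have hev : ∀ (c : R) (v : σ → R), eval v (P c) = eval (Function.update v i c) p := by
    intro c v
    refine (eval₂Hom_bind₁ _ _ _ p).trans ?_
    change eval₂Hom _ _ p = eval₂Hom _ _ p
    congr 2
    funext j
    rcases eq_or_ne j i with rfl | hj <;> simp [*]
  have hdeg : ∀ c, (P c).degreeOf i = 0 := by
    intro c
    by_contra hne
    obtain ⟨j, -, hj⟩ := mem_vars_bind₁ _ _ (mem_vars_iff_degreeOf_ne_zero.mpr hne)
    rcases eq_or_ne j i with rfl | hji
    · simp at hj
    · rw [Function.update_of_ne hji, vars_X, Finset.mem_singleton] at hj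
      exact hji hj.symm
  have hp : p = P 0 + X i * (P 1 - P 0) := by
    refine MvPolynomial.funext fun v => ?_
    have := h v (v i)
    rw [Function.update_eq_self] at this
    simp only [map_add, map_mul, map_sub, eval_X, hev, this]
  rw [hp]
  have h₁ := degreeOf_add_le i (P 0) (X i * (P 1 - P 0))
  have h₂ := degreeOf_mul_le i (X i) (P 1 - P 0)
  have h₃ := degreeOf_sub_le i (P 1) (P 0)
  have h₄ : (X i : MvPolynomial σ R).degreeOf i ≤ 1 := by simp
  simp only [hdeg] at h₁ h₃
  omega

end MvPolynomial

/-- The jet at `0` of a formal power series. -/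
noncomputable def PowerSeries.jet (f : PowerSeries ℂ) (j : ℕ) : ℂ := j.factorial * f.coeff j

/-- The formal power series with a given jet at `0`. -/
noncomputable def PowerSeries.ofJet (a : ℕ → ℂ) : PowerSeries ℂ := .mk fun j => a j / j.factorial

theorem PowerSeries.jet_ofJet (a : ℕ → ℂ) : (PowerSeries.ofJet a).jet = a := by
  funext j
  simp [jet, ofJet, mul_div_cancel₀, Nat.factorial_ne_zero]

theorem PowerSeries.ofJet_jet (f : PowerSeries ℂ) : PowerSeries.ofJet f.jet = f := by
  ext j
  simp [jet, ofJet, Nat.factorial_ne_zero]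

theorem ofJet_mul_ofJet_iota {a : ℕ → ℂ} (ha : a 0 ≠ 0) :
    PowerSeries.ofJet a * PowerSeries.ofJet (iota a) = 1 := by
  ext k
  rw [PowerSeries.coeff_mul, PowerSeries.coeff_one]
  cases k with
  | zero => simp [PowerSeries.ofJet, iota, ha]
  | succ k =>
    rw [Finset.Nat.sum_antidiagonal_eq_sum_range_succ_mk, Finset.sum_range_succ', if_neg (by simp)]
    have hf : ∀ m : ℕ, (m.factorial : ℂ) ≠ 0 := fun m => by
      exact_mod_cast m.factorial_ne_zero
    have hiota : a 0 * iota a (k + 1) =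
        -∑ j ∈ Finset.range (k+1), ((k+1).choose (j+1) : ℂ) * a (j+1) * iota a (k - j) := by
      rw [iota]
      field_simp
    simp only [PowerSeries.ofJet, PowerSeries.coeff_mk, Nat.sub_zero, Nat.factorial_zero,
      Nat.cast_one, div_one, ← mul_div_assoc]
    rw [hiota, neg_div, Finset.sum_div, ← sub_eq_add_neg, sub_eq_zero]
    refine Finset.sum_congr rfl fun j hj => ?_
    have hj : j + 1 ≤ k + 1 := Finset.mem_range.mp hj
    rw [Nat.cast_choose ℂ hj, Nat.add_sub_add_right]
    have := hf (j + 1)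
    have := hf (k - j)
    have := hf (k + 1)
    field_simp

theorem iota_jet {f : PowerSeries ℂ} (hf : f.constantCoeff ≠ 0) : iota f.jet = f⁻¹.jet := by
  have h0 : f.jet 0 ≠ 0 := by simpa [PowerSeries.jet] using hf
  have h := ofJet_mul_ofJet_iota h0
  rw [PowerSeries.ofJet_jet, mul_comm] at h
  rw [(PowerSeries.inv_eq_iff_mul_eq_one hf).mpr h, PowerSeries.jet_ofJet]

theorem PowerSeries.tendsto_coeff_inv {α : Type*} {F : Filter α} {f : α → PowerSeries ℂ}
    {g : PowerSeries ℂ} (hg : g.constantCoeff ≠ 0)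
    (h : ∀ j, Tendsto (fun s => (f s).coeff j) F (𝓝 (g.coeff j))) (j : ℕ) :
    Tendsto (fun s => (f s)⁻¹.coeff j) F (𝓝 (g⁻¹.coeff j)) := by
  have h0 : Tendsto (fun s => (f s).constantCoeff⁻¹) F (𝓝 g.constantCoeff⁻¹) := by
    simpa using (h 0).inv₀ (by simpa using hg)
  induction j using Nat.strong_induction_on with
  | _ j ih =>
    simp only [PowerSeries.coeff_inv j]
    split_ifs with hj
    · exact h0
    · refine h0.neg.mul (tendsto_finsetSum _ fun x _ => ?_)
      split_ifs with hx
      · exact (h x.1).mul (ih x.2 hx)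
      · exact tendsto_const_nhds

theorem PowerSeries.tendsto_coeff_mul {α : Type*} {F : Filter α} {f f' : α → PowerSeries ℂ}
    {g g' : PowerSeries ℂ} (h : ∀ j, Tendsto (fun s => (f s).coeff j) F (𝓝 (g.coeff j)))
    (h' : ∀ j, Tendsto (fun s => (f' s).coeff j) F (𝓝 (g'.coeff j))) (j : ℕ) :
    Tendsto (fun s => (f s * f' s).coeff j) F (𝓝 ((g * g').coeff j)) := by
  simp only [PowerSeries.coeff_mul]
  exact tendsto_finsetSum _ fun x _ => (h x.1).mul (h' x.2)

/-- Along a family of jets with a simple pole in the parameter whose inverses converge, a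
polynomial in `Sn n` has a pole of order at most `n`. -/
theorem tendsto_pow_mul_eval_jet {n : ℕ} {ρ : MvPolynomial ℕ ℂ} (hρ : ρ ∈ Sn n)
    {f : ℂ → PowerSeries ℂ} {g : PowerSeries ℂ} {c : ℂ}
    (hf : ∀ᶠ s in 𝓝[≠] 0, (f s).constantCoeff ≠ 0)
    (hc : Tendsto (fun s => s * (f s).constantCoeff) (𝓝[≠] 0) (𝓝 c))
    (hg : ∀ j, Tendsto (fun s => (f s)⁻¹.coeff j) (𝓝[≠] 0) (𝓝 (g.coeff j))) :
    ∃ l, Tendsto (fun s => s ^ n * eval (f s).jet ρ) (𝓝[≠] 0) (𝓝 l) := by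
  obtain ⟨-, ρ₂, -, hrel⟩ := hρ
  have hjet : Tendsto (fun s => (f s)⁻¹.jet) (𝓝[≠] 0) (𝓝 g.jet) :=
    tendsto_pi_nhds.mpr fun j => (hg j).const_mul _
  refine ⟨_, ((hc.pow n).mul ((ρ₂.continuous_eval.tendsto _).comp hjet)).congr' ?_⟩
  filter_upwards [hf] with s hs
  have h0 : (f s).jet 0 = (f s).constantCoeff := by simp [PowerSeries.jet]
  rw [hrel _ (h0 ▸ hs), iota_jet hs, h0, mul_pow, mul_assoc, Function.comp_apply]

theorem totalDegree_le_of_mem_Sn {n : ℕ} {ρ : MvPolynomial ℕ ℂ} (hρ : ρ ∈ Sn n) :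
    ρ.totalDegree ≤ n := by
  refine totalDegree_le_of_tendsto 0 fun a ha => ?_
  let g := PowerSeries.ofJet a
  have hg : g.constantCoeff = a 0 := by
    rw [← PowerSeries.coeff_zero_eq_constantCoeff_apply]
    simp [g, PowerSeries.ofJet]
  have hjet : ∀ s : ℂ, (s⁻¹ • g).jet = fun i => s⁻¹ * a i := by
    intro s
    funext j
    have := congrFun (PowerSeries.jet_ofJet a) j
    rw [← this]
    simp only [PowerSeries.jet, g, PowerSeries.coeff_smul, smul_eq_mul]
    ring
  have hne : ∀ᶠ s : ℂ in 𝓝[≠] 0, s ≠ 0 := self_mem_nhdsWithin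
  simp only [← hjet]
  refine tendsto_pow_mul_eval_jet hρ (c := a 0) (g := 0) ?_ ?_ fun j => ?_
  · filter_upwards [hne] with s hs
    simp [hg, hs, ha]
  · refine tendsto_const_nhds.congr' ?_
    filter_upwards [hne] with s hs
    simp [hg, hs]
  · have : Tendsto (fun s : ℂ => s * g⁻¹.coeff j) (𝓝[≠] 0) (𝓝 (0 * g⁻¹.coeff j)) :=
      (tendsto_id.mono_left nhdsWithin_le_nhds).mul_const _
    simpa [PowerSeries.smul_inv] using this

/-- The restriction of `ρ` to the jets of the functions `p + A / (1 - B t)`, as a polynomial in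
`A` and `B`. -/
noncomputable def simplePoleRestriction (p : ℕ → ℂ) (ρ : MvPolynomial ℕ ℂ) :
    MvPolynomial (Fin 2) ℂ :=
  bind₁ (fun j => C (p j) + C (j.factorial : ℂ) * (X 0 * X 1 ^ j)) ρ

theorem eval_simplePoleRestriction (p : ℕ → ℂ) (ρ : MvPolynomial ℕ ℂ) (v : Fin 2 → ℂ) :
    eval v (simplePoleRestriction p ρ) =
      eval (fun j => p j + j.factorial * (v 0 * v 1 ^ j)) ρ := by
  refine (eval₂Hom_bind₁ _ _ _ ρ).trans ?_
  change eval₂Hom _ _ ρ = eval₂Hom _ _ ρ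
  congr 2
  funext j
  simp

theorem totalDegree_simplePoleRestriction_le {n : ℕ} {ρ : MvPolynomial ℕ ℂ} (hρ : ρ ∈ Sn n)
    (p : ℕ → ℂ) : (simplePoleRestriction p ρ).totalDegree ≤ n := by
  refine totalDegree_le_of_tendsto 0 fun v hv => ?_
  have hne : ∀ᶠ s : ℂ in 𝓝[≠] 0, s ≠ 0 := self_mem_nhdsWithin
  have hid : Tendsto (fun s : ℂ => s) (𝓝[≠] 0) (𝓝 0) := nhdsWithin_le_nhds
  let P := PowerSeries.ofJet p
  let G : ℂ → PowerSeries ℂ := fun s => .mk fun j => (s⁻¹ * v 0) * (s⁻¹ * v 1) ^ j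
  let D : ℂ → PowerSeries ℂ := fun s => PowerSeries.C s - PowerSeries.C (v 1) * PowerSeries.X
  let N : ℂ → PowerSeries ℂ := fun s => PowerSeries.C (v 0) + P * D s
  have hGD : ∀ s : ℂ, s ≠ 0 → G s * D s = PowerSeries.C (v 0) := by
    intro s hs
    ext j
    cases j with
    | zero => simp [G, D, hs, mul_sub, mul_right_comm]
    | succ j =>
      simp only [G, D, mul_sub, ← mul_assoc, map_sub, PowerSeries.coeff_succ_mul_X,
        PowerSeries.coeff_mul_C, PowerSeries.coeff_mk, PowerSeries.coeff_C]
      simp only [Nat.succ_ne_zero, if_false, sub_eq_zero, pow_succ]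
      field_simp
  have hD : ∀ j, Tendsto (fun s => (D s).coeff j) (𝓝[≠] 0) (𝓝 ((D 0).coeff j)) := by
    intro j
    simp only [D, map_sub, PowerSeries.coeff_C]
    refine Tendsto.sub_const ?_ _
    split_ifs
    · exact hid
    · exact tendsto_const_nhds
  have hN : ∀ j, Tendsto (fun s => (N s).coeff j) (𝓝[≠] 0) (𝓝 ((N 0).coeff j)) := by
    intro j
    simp only [N, map_add]
    exact (PowerSeries.tendsto_coeff_mul (fun _ => tendsto_const_nhds) hD j).const_add _
  have hN0 : (N 0).constantCoeff ≠ 0 := by simpa [N, D] using hv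
  have hNc : Tendsto (fun s => (N s).constantCoeff) (𝓝[≠] 0) (𝓝 (N 0).constantCoeff) := by
    simpa using hN 0
  have hfD : ∀ s : ℂ, s ≠ 0 → (P + G s) * D s = N s := by
    intro s hs
    rw [add_mul, hGD s hs, add_comm]
  have hDc : ∀ s, (D s).constantCoeff = s := by simp [D]
  have hfc : ∀ s : ℂ, s ≠ 0 → s * (P + G s).constantCoeff = (N s).constantCoeff := by
    intro s hs
    rw [← hfD s hs, map_mul, hDc, mul_comm]
  have hjet : ∀ s : ℂ, (P + G s).jet =
      fun j => p j + j.factorial * ((s⁻¹ * v 0) * (s⁻¹ * v 1) ^ j) := by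
    intro s
    funext j
    have := congrFun (PowerSeries.jet_ofJet p) j
    rw [← this]
    simp only [PowerSeries.jet, P, G, map_add, PowerSeries.coeff_mk]
    ring
  simp only [eval_simplePoleRestriction, ← hjet]
  refine tendsto_pow_mul_eval_jet hρ (c := (N 0).constantCoeff) (g := D 0 * (N 0)⁻¹) ?_ ?_ ?_
  · filter_upwards [hne, hNc.eventually_ne hN0] with s hs hNs h0
    rw [← hfc s hs, h0, mul_zero] at hNs
    exact hNs rfl
  · refine hNc.congr' ?_
    filter_upwards [hne] with s hs using (hfc s hs).symm
  · intro j
    refine (PowerSeries.tendsto_coeff_mul hD (PowerSeries.tendsto_coeff_inv hN0 hN) j).congr' ?_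
    filter_upwards [hne] with s hs
    rw [← hfD s hs, PowerSeries.mul_inv_rev, ← mul_assoc,
      PowerSeries.mul_inv_cancel _ (by rwa [hDc]), one_mul]

/-- A bivariate polynomial of total degree at most `n` becomes affine in `z` in the limit
`ε → 0` on the curves `(z ε^(n-1), ε⁻¹)`. -/
theorem tendsto_affine_defect {n : ℕ} (hn : 1 ≤ n) {H : MvPolynomial (Fin 2) ℂ}
    (hH : H.totalDegree ≤ n) (z : ℂ) :
    Tendsto (fun ε : ℂ => eval ![z * ε ^ (n - 1), ε⁻¹] H - (eval ![0 * ε ^ (n - 1), ε⁻¹] H +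
      z * (eval ![1 * ε ^ (n - 1), ε⁻¹] H - eval ![0 * ε ^ (n - 1), ε⁻¹] H)))
      (𝓝[≠] 0) (𝓝 0) := by
  have hterm : ∀ m ∈ H.support, Tendsto (fun ε : ℂ => coeff m H *
      ((z ^ m 0 - (0 ^ m 0 + z * (1 ^ m 0 - 0 ^ m 0))) * (ε ^ ((n - 1) * m 0) * (ε⁻¹) ^ m 1)))
      (𝓝[≠] 0) (𝓝 0) := by
    intro m hm
    have hdeg : m 0 + m 1 ≤ n := by
      have := (le_totalDegree hm).trans hH
      rwa [Finsupp.sum_fintype _ _ (fun _ => rfl), Fin.sum_univ_two] at this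
    rcases lt_or_ge (m 0) 2 with h2 | h2
    · have : z ^ m 0 - (0 ^ m 0 + z * (1 ^ m 0 - 0 ^ m 0)) = 0 := by
        interval_cases m 0 <;> simp
      simp only [this, zero_mul, mul_zero, tendsto_const_nhds]
    · obtain ⟨e, he, he0⟩ : ∃ e, (n - 1) * m 0 = e + m 1 ∧ e ≠ 0 := by
        obtain ⟨k, rfl⟩ : ∃ k, n = k + 1 := ⟨n - 1, by omega⟩
        obtain ⟨d, hd⟩ : ∃ d, m 0 = d + 2 := ⟨m 0 - 2, by omega⟩
        refine ⟨k * m 0 - m 1, ?_, ?_⟩ <;> simp only [Nat.add_sub_cancel, hd] at * <;>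
          have := Nat.zero_le (k * d) <;> rw [mul_add] <;> omega
      have hlim : Tendsto (fun ε : ℂ => ε ^ e) (𝓝[≠] 0) (𝓝 0) := by
        have := ((continuous_pow e).tendsto (0 : ℂ)).mono_left
          (nhdsWithin_le_nhds (s := {0}ᶜ))
        rwa [zero_pow he0] at this
      have := (hlim.const_mul (z ^ m 0 - (0 ^ m 0 + z * (1 ^ m 0 - 0 ^ m 0)))).const_mul
        (coeff m H)
      rw [mul_zero, mul_zero] at this
      refine this.congr' ?_
      filter_upwards [self_mem_nhdsWithin] with ε hε
      have hε : ε ≠ 0 := hε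
      rw [he, pow_add, mul_assoc (ε ^ e), ← mul_pow, mul_inv_cancel₀ hε, one_pow (m 1), mul_one]
  have := tendsto_finsetSum H.support hterm
  rw [Finset.sum_const_zero] at this
  refine this.congr fun ε => ?_
  simp only [eval_eq', Fin.prod_univ_two, Matrix.cons_val_zero, Matrix.cons_val_one, mul_pow,
    ← pow_mul, ← Finset.sum_sub_distrib, Finset.mul_sum, ← Finset.sum_add_distrib]
  refine Finset.sum_congr rfl fun m _ => ?_
  ring

theorem degreeOf_le_one_of_mem_Sn {n : ℕ} (hn : 1 ≤ n) {ρ : MvPolynomial ℕ ℂ} (hρ : ρ ∈ Sn n) :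
    ρ.degreeOf (n - 1) ≤ 1 := by
  refine degreeOf_le_one_of_eval_update (n - 1) fun v z => ?_
  let p := Function.update v (n - 1) 0
  have hf : ((n - 1).factorial : ℂ) ≠ 0 := by exact_mod_cast (n - 1).factorial_ne_zero
  have hlim : ∀ y : ℂ, Tendsto
      (fun ε : ℂ => eval ![y * ε ^ (n - 1), ε⁻¹] (simplePoleRestriction p ρ))
      (𝓝[≠] 0) (𝓝 (eval (Function.update v (n - 1) ((n - 1).factorial * y)) ρ)) := by
    intro y
    let w : ℂ → ℕ → ℂ := fun ε j => p j + j.factorial * (y * ε ^ (n - 1 - j))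
    have hsupp : ∀ j ∈ ρ.vars, j < n := fun j hj => mem_supported.mp hρ.1 hj
    have hcont : Continuous fun ε => eval (w ε) ρ := by
      refine ρ.continuous_eval.comp (continuous_pi fun j => ?_)
      fun_prop
    have h0 : eval (w 0) ρ = eval (Function.update v (n - 1) ((n - 1).factorial * y)) ρ := by
      refine eval₂Hom_congr' rfl (fun j hj _ => ?_) rfl
      have := hsupp j hj
      rcases eq_or_ne j (n - 1) with rfl | hne
      · simp [w, p]
      · simp [w, p, hne, zero_pow (show n - 1 - j ≠ 0 by omega)]
    rw [← h0]
    refine ((hcont.tendsto 0).mono_left nhdsWithin_le_nhds).congr' ?_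
    filter_upwards [self_mem_nhdsWithin] with ε hε
    have hε : ε ≠ 0 := hε
    rw [eval_simplePoleRestriction]
    refine eval₂Hom_congr' rfl (fun j hj _ => ?_) rfl
    have := hsupp j hj
    simp only [w, Matrix.cons_val_zero, Matrix.cons_val_one]
    rw [show n - 1 = n - 1 - j + j by omega, pow_add, Nat.add_sub_cancel, mul_assoc, mul_assoc,
      ← mul_pow, mul_inv_cancel₀ hε, one_pow, mul_one]
  have haff : ∀ y : ℂ, eval (Function.update v (n - 1) ((n - 1).factorial * y)) ρ =
      eval (Function.update v (n - 1) ((n - 1).factorial * 0)) ρ +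
        y * (eval (Function.update v (n - 1) ((n - 1).factorial * 1)) ρ -
          eval (Function.update v (n - 1) ((n - 1).factorial * 0)) ρ) := by
    intro y
    exact sub_eq_zero.mp (tendsto_nhds_unique
      ((hlim y).sub ((hlim 0).add (((hlim 1).sub (hlim 0)).const_mul y)))
      (tendsto_affine_defect hn (totalDegree_simplePoleRestriction_le hρ p) y))
  have hz := haff (z / (n - 1).factorial)
  have h1 := haff (1 / (n - 1).factorial)
  simp only [mul_div_cancel₀ _ hf, mul_zero] at hz h1
  rw [hz, h1]
  ring

/-- Let `n ≥ 1` and `ρ ∈ Sₙ`. Then the total degree of `ρ` is at most `n`, and its degree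
in the single variable `x_{n−1}` is at most `1`. -/
theorem stmt11 (n : ℕ) (hn : 1 ≤ n) (ρ : MvPolynomial ℕ ℂ) (hρ : ρ ∈ Sn n) :
    ρ.totalDegree ≤ n ∧ ρ.degreeOf (n - 1) ≤ 1 := by
  exact ⟨totalDegree_le_of_mem_Sn hρ, degreeOf_le_one_of_mem_Sn hn hρ⟩
end
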